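/- arXiv:2203.02971 — 2 statements merged into one kernel-verified Lean document; each statement's English description precedes it below -/
import Mathlib

section
/- Let G be a finite supersolvable group having a noncyclic Sylow 2-subgroup, and let X be a subset of G \ {1} with X = X⁻¹, |X| ≥ 4 and ⟨X⟩ = G. Then the Cayley graph Cay(G,X) admits a nowhere-zero 3-flow. -/
/-- A nowhere-zero 3-flow on a finite simple graph: an antisymmetric integer-valued
function on ordered pairs of vertices, vanishing on non-adjacent pairs, with
`0 < |f u v| < 3` on adjacent pairs, and with zero net flow at every vertex. -/
def HasNowhereZero3Flow {V : Type*} [Fintype V] (G : SimpleGraph V) : Prop :=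
  ∃ f : V → V → ℤ,
    (∀ u v, f u v = - f v u) ∧
    (∀ u v, ¬ G.Adj u v → f u v = 0) ∧
    (∀ u v, G.Adj u v → 0 < |f u v| ∧ |f u v| < 3) ∧
    ∀ u, ∑ v, f u v = 0

/-- The Cayley graph of a group with connection set `X`: `g` and `h` are adjacent
iff `g⁻¹ * h ∈ X` (for `X` inverse-closed with `1 ∉ X` this is symmetric and loopless). -/
def cayleyGraph {G : Type*} [Group G] (X : Set G) : SimpleGraph G :=
  SimpleGraph.fromRel (fun g h => g⁻¹ * h ∈ X)

/-- A finite group is supersolvable if it has a chain of subgroups from `⊥` to `⊤`,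
each normal in the whole group, with all successive quotients cyclic. -/
def IsSupersolvable (G : Type*) [Group G] : Prop :=
  ∃ (n : ℕ) (c : Fin (n + 1) → Subgroup G) (hc : ∀ i, (c i).Normal),
    Monotone c ∧ c 0 = ⊥ ∧ c (Fin.last n) = ⊤ ∧
    ∀ i : Fin n,
      IsCyclic ↥(Subgroup.map (@QuotientGroup.mk' G _ (c i.castSucc) (hc i.castSucc)) (c i.succ))

section Nets

variable {G : Type*} [Group G]

/-- The edges of the Cayley digraph labelled by `Y` carry a nowhere-zero antisymmetric function
with values in `{±1, ±2}` whose net outflow is `φ`. -/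
def HasNet (Y : Finset G) (φ : G → ℤ) : Prop :=
  (∀ y ∈ Y, y⁻¹ ∈ Y) ∧ ∃ F : G → G → ℤ,
    (∀ g, ∀ y ∈ Y, F (g * y) y⁻¹ = -F g y) ∧
    (∀ g, ∀ y ∈ Y, 0 < |F g y| ∧ |F g y| < 3) ∧
    ∀ g, ∑ y ∈ Y, F g y = φ g

theorem HasNet.hasNowhereZero3Flow [Fintype G] {X : Finset G} (h1 : (1 : G) ∉ X)
    (h : HasNet X 0) : HasNowhereZero3Flow (cayleyGraph (X : Set G)) := by
  classical
  obtain ⟨hX, F, hF, hF3, hsum⟩ := h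
  have hadj : ∀ u v : G, (cayleyGraph (X : Set G)).Adj u v ↔ u⁻¹ * v ∈ X := by
    intro u v
    simp only [cayleyGraph, SimpleGraph.fromRel_adj, Finset.mem_coe]
    constructor
    · rintro ⟨-, h | h⟩
      · exact h
      · simpa using hX _ h
    · intro h
      refine ⟨?_, Or.inl h⟩
      rintro rfl
      simp [h1] at h
  refine ⟨fun u v => if u⁻¹ * v ∈ X then F u (u⁻¹ * v) else 0, ?_, ?_, ?_, ?_⟩
  · intro u v
    by_cases h : u⁻¹ * v ∈ X
    · have h' : v⁻¹ * u ∈ X := by simpa using hX _ h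
      have := hF u _ h
      simp only [mul_inv_cancel_left, mul_inv_rev, inv_inv] at this
      simp [h, h', this]
    · have h' : v⁻¹ * u ∉ X := fun h' => h (by simpa using hX _ h')
      simp [h, h']
  · intro u v h
    rw [hadj] at h
    simp [h]
  · intro u v h
    rw [hadj] at h
    simpa [h] using hF3 u _ h
  · intro u
    rw [← Equiv.sum_comp (Equiv.mulLeft u)]
    simpa [Finset.sum_ite_mem] using hsum u

theorem hasNet_empty : HasNet (∅ : Finset G) 0 :=
  ⟨by simp, fun _ _ => 1, by simp, by simp, by simp⟩

theorem HasNet.congr {Y : Finset G} {φ ψ : G → ℤ} (h : HasNet Y φ) (e : ∀ g, φ g = ψ g) :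
    HasNet Y ψ := by
  obtain rfl : φ = ψ := funext e
  exact h

theorem hasNet_single {t : G} (ht : t * t = 1) (f : G → ℤ) (hf : ∀ g, f (g * t) = -f g)
    (hs : ∀ g, 0 < |f g| ∧ |f g| < 3) : HasNet {t} f := by
  have hti : t⁻¹ = t := inv_eq_of_mul_eq_one_left ht
  exact ⟨by simp [hti], fun g _ => f g, by simpa using hf, by simpa using hs, by simp⟩

variable [DecidableEq G]

theorem HasNet.union {Y Z : Finset G} {φ ψ : G → ℤ} (hY : HasNet Y φ) (hZ : HasNet Z ψ)
    (hd : Disjoint Y Z) : HasNet (Y ∪ Z) (φ + ψ) := by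
  obtain ⟨iY, F, hF, hF3, hFs⟩ := hY
  obtain ⟨iZ, E, hE, hE3, hEs⟩ := hZ
  have hnot : ∀ y ∈ Z, y ∉ Y := fun y hz hy => Finset.disjoint_left.mp hd hy hz
  refine ⟨?_, fun g y => if y ∈ Y then F g y else E g y, ?_, ?_, ?_⟩
  · intro y hy
    rw [Finset.mem_union] at hy ⊢
    exact hy.imp (iY y) (iZ y)
  · intro g y hy
    rcases Finset.mem_union.mp hy with h | h
    · simp [h, iY y h, hF g y h]
    · simp [hnot _ h, hnot _ (iZ y h), hE g y h]
  · intro g y hy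
    rcases Finset.mem_union.mp hy with h | h
    · simpa [h] using hF3 g y h
    · simpa [hnot _ h] using hE3 g y h
  · intro g
    rw [Finset.sum_union hd, Pi.add_apply, ← hFs, ← hEs]
    congr 1
    · exact Finset.sum_congr rfl fun y hy => by simp [hy]
    · exact Finset.sum_congr rfl fun y hy => by simp [hnot y hy]

theorem hasNet_pair {w : G} (hw : w ≠ w⁻¹) (f : G → ℤ)
    (hs : ∀ g, 0 < |f g| ∧ |f g| < 3) :
    HasNet {w, w⁻¹} (fun g => f g - f (g * w⁻¹)) := by
  refine ⟨by simp [or_comm], fun g y => if y = w then f g else -f (g * w⁻¹), ?_, ?_, ?_⟩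
  · intro g y hy
    rcases Finset.mem_insert.mp hy with rfl | hy
    · simp [hw.symm]
    · rw [Finset.mem_singleton] at hy
      subst hy
      simp [hw.symm]
  · intro g y hy
    by_cases h : y = w
    · simpa [h] using hs g
    · simpa [h] using hs (g * w⁻¹)
  · intro g
    rw [Finset.sum_pair hw]
    simp [hw.symm, sub_eq_add_neg]

theorem intUnit_cases (u : ℤˣ) : (u : ℤ) = 1 ∨ (u : ℤ) = -1 := by
  rcases Int.units_eq_one_or u with h | h <;> simp [h]

theorem small_intUnit (u : ℤˣ) : 0 < |(u : ℤ)| ∧ |(u : ℤ)| < 3 := by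
  rcases intUnit_cases u with h | h <;> simp [h]

theorem small_neg_intUnit (u : ℤˣ) : 0 < |(-u : ℤ)| ∧ |(-u : ℤ)| < 3 := by
  rcases intUnit_cases u with h | h <;> simp [h]

theorem small_two_mul_intUnit (u : ℤˣ) : 0 < |2 * (u : ℤ)| ∧ |2 * (u : ℤ)| < 3 := by
  rcases intUnit_cases u with h | h <;> simp [h]

theorem hasNet_two_involutions {s t : G} (hs : s * s = 1) (ht : t * t = 1) (hne : s ≠ t)
    (ε : G → ℤˣ) (es : ∀ g, ε (g * s) = -ε g) (et : ∀ g, ε (g * t) = -ε g) :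
    HasNet {s, t} 0 := by
  have A := hasNet_single hs (fun g => (ε g : ℤ)) (by simp [es]) fun g => small_intUnit _
  have B := hasNet_single ht (fun g => -(ε g : ℤ)) (by simp [et]) fun g => small_neg_intUnit _
  exact (A.union B (by simpa using hne)).congr (by simp)

theorem hasNet_three_involutions {r s t : G} (hr : r * r = 1) (hs : s * s = 1) (ht : t * t = 1)
    (hrs : r ≠ s) (hrt : r ≠ t) (hst : s ≠ t)
    (ε : G → ℤˣ) (er : ∀ g, ε (g * r) = -ε g) (es : ∀ g, ε (g * s) = -ε g)
    (et : ∀ g, ε (g * t) = -ε g) :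
    HasNet {r, s, t} 0 := by
  have R := hasNet_single hr (fun g => 2 * (ε g : ℤ)) (by simp [er])
    fun g => small_two_mul_intUnit _
  have A := hasNet_single hs (fun g => -(ε g : ℤ)) (by simp [es]) fun g => small_neg_intUnit _
  have B := hasNet_single ht (fun g => -(ε g : ℤ)) (by simp [et]) fun g => small_neg_intUnit _
  refine (R.union (A.union B (by simpa using hst)) ?_).congr ?_
  · simp [hrs, hrt]
  · intro g
    simp only [Pi.add_apply, Pi.zero_apply]
    ring

theorem hasNet_involution_pair {t x : G} (ht : t * t = 1) (hx : x ≠ x⁻¹)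
    (ε : G → ℤˣ) (et : ∀ g, ε (g * t) = -ε g) (ex : ∀ g, ε (g * x) = -ε g) :
    HasNet {t, x, x⁻¹} 0 := by
  have hti : t⁻¹ = t := inv_eq_of_mul_eq_one_left ht
  have T := hasNet_single ht (fun g => 2 * (ε g : ℤ)) (by simp [et])
    fun g => small_two_mul_intUnit _
  have P := hasNet_pair hx (fun g => -(ε g : ℤ)) fun g => small_neg_intUnit _
  refine (T.union P ?_).congr ?_
  · rw [Finset.disjoint_singleton_left]
    intro h
    rcases Finset.mem_insert.mp h with rfl | h
    · exact hx hti.symm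
    · rw [Finset.mem_singleton] at h
      subst h
      exact hx (by simpa using hti)
  · intro g
    have : ε g = -ε (g * x⁻¹) := by simpa using ex (g * x⁻¹)
    simp only [Pi.add_apply, Pi.zero_apply, this]
    push_cast
    ring

end Nets

section Signs

theorem exists_right_equivariant {G : Type*} [Group G] (H : Subgroup G) :
    ∃ ρ : G → H, ∀ g (h : H), ρ (g * h) = ρ g * h := by
  have key : ∀ g : G, ((QuotientGroup.mk g : G ⧸ H).out)⁻¹ * g ∈ H := fun g => by
    rw [← QuotientGroup.eq, QuotientGroup.out_eq']
  refine ⟨fun g => ⟨_, key g⟩, fun g h => ?_⟩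
  have : (QuotientGroup.mk (g * h) : G ⧸ H) = QuotientGroup.mk g := by
    rw [eq_comm, QuotientGroup.eq]
    simp
  ext
  simp [this, mul_assoc]

theorem exists_hom_of_index_two {S : Type*} [Group S] {K : Subgroup S} (hK : K.index = 2) :
    ∃ χ : S →* ℤˣ, ∀ s, χ s = 1 ↔ s ∈ K := by
  classical
  refine ⟨MonoidHom.mk' (fun s => if s ∈ K then 1 else -1) fun a b => ?_, fun s => ?_⟩
  · have := Subgroup.mul_mem_iff_of_index_two hK (a := a) (b := b)
    by_cases ha : a ∈ K <;> by_cases hb : b ∈ K <;> simp_all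
  · by_cases h : s ∈ K <;> simp [h]

theorem exists_index_two_ge {S : Type*} [Group S] [Finite S] (hS : IsPGroup 2 S)
    {A : Subgroup S} (hA : A ≠ ⊤) : ∃ K : Subgroup S, A ≤ K ∧ K.index = 2 := by
  have : Fact (Nat.Prime 2) := ⟨Nat.prime_two⟩
  obtain ⟨n, hn⟩ := IsPGroup.iff_card.mp hS
  obtain ⟨m, hm⟩ := IsPGroup.iff_card.mp (hS.to_subgroup A)
  have hmn : m < n := by
    have h1 : Nat.card A < Nat.card S := by
      refine lt_of_le_of_ne (Subgroup.card_le_card_group A) fun h => hA ?_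
      exact Subgroup.eq_top_of_card_eq A h
    rw [hn, hm] at h1
    exact (Nat.pow_lt_pow_iff_right (by norm_num)).mp h1
  obtain ⟨k, rfl⟩ : ∃ k, n = k + 1 := ⟨n - 1, by omega⟩
  obtain ⟨K, hK, hAK⟩ := Sylow.exists_subgroup_card_pow_prime_le 2 (n := m) (m := k)
    (by rw [hn]; exact pow_dvd_pow 2 (Nat.le_succ k)) A hm (by omega)
  refine ⟨K, hAK, ?_⟩
  have := K.card_mul_index
  rw [hK, hn, pow_succ] at this
  exact Nat.eq_of_mul_eq_mul_left (by positivity) this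

/-- In a finite 2-group, `u ∉ A` is detected by a sign function that is right `A`-invariant. -/
theorem exists_sign_of_notMem {P : Type*} [Group P] [Finite P] (hP : IsPGroup 2 P)
    {A : Subgroup P} {u : P} (hu : u ∉ A) :
    ∃ ε : P → ℤˣ, (∀ g, ∀ a ∈ A, ε (g * a) = ε g) ∧ ∀ g, ε (g * u) = -ε g := by
  let S := A ⊔ Subgroup.zpowers u
  have hAS : A ≤ S := le_sup_left
  have huS : u ∈ S := (le_sup_right : Subgroup.zpowers u ≤ S) (Subgroup.mem_zpowers u)
  have hA : A.subgroupOf S ≠ ⊤ := by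
    rw [Ne, Subgroup.subgroupOf_eq_top]
    exact fun h => hu (h huS)
  obtain ⟨K, hAK, hK⟩ := exists_index_two_ge (hP.to_subgroup S) hA
  obtain ⟨χ, hχ⟩ := exists_hom_of_index_two hK
  obtain ⟨ρ, hρ⟩ := exists_right_equivariant S
  have hA1 : ∀ a (ha : a ∈ A), χ ⟨a, hAS ha⟩ = 1 := fun a ha =>
    (hχ _).mpr (hAK (by simpa [Subgroup.mem_subgroupOf] using ha))
  have huK : (⟨u, huS⟩ : S) ∉ K := by
    intro h
    have hle : S ≤ K.map S.subtype := by
      refine sup_le (fun a ha => ⟨⟨a, hAS ha⟩, hAK ?_, rfl⟩) ?_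
      · simpa [Subgroup.mem_subgroupOf] using ha
      · rw [Subgroup.zpowers_le]
        exact ⟨_, h, rfl⟩
    have : K = ⊤ := by
      rw [eq_top_iff]
      rintro ⟨s, hs⟩ -
      obtain ⟨x, hx, rfl⟩ := hle hs
      exact hx
    rw [this, Subgroup.index_top] at hK
    norm_num at hK
  have hu1 : χ ⟨u, huS⟩ = -1 :=
    (Int.units_eq_one_or _).resolve_left fun h => huK ((hχ _).mp h)
  refine ⟨fun g => χ (ρ g), fun g a ha => ?_, fun g => ?_⟩
  · have := hρ g ⟨a, hAS ha⟩
    simp only at this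
    simp [this, hA1 a ha]
  · have := hρ g ⟨u, huS⟩
    simp only at this
    simp [this, hu1]

theorem exists_two_signs {P : Type*} [Group P] [Finite P] (hP : IsPGroup 2 P)
    (hnc : ¬ IsCyclic P) :
    ∃ χ₁ χ₂ : P →* ℤˣ, χ₁ ≠ 1 ∧ χ₂ ≠ 1 ∧ χ₁ ≠ χ₂ := by
  have hbot : (⊥ : Subgroup P) ≠ ⊤ := by
    intro h
    apply hnc
    have : Subsingleton P := by
      rw [← Subgroup.subsingleton_iff]
      exact subsingleton_iff_bot_eq_top.mp h
    infer_instance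
  obtain ⟨A, -, hA⟩ := exists_index_two_ge hP hbot
  have hAtop : A ≠ ⊤ := by
    rintro rfl
    rw [Subgroup.index_top] at hA
    norm_num at hA
  obtain ⟨y, hy⟩ : ∃ y, y ∉ A := by
    by_contra! h
    exact hAtop ((Subgroup.eq_top_iff' A).mpr h)
  have hytop : Subgroup.zpowers y ≠ ⊤ := fun h =>
    hnc ⟨y, fun x => (Subgroup.eq_top_iff' _).mp h x⟩
  obtain ⟨B, hyB, hB⟩ := exists_index_two_ge hP hytop
  have hBtop : B ≠ ⊤ := by
    rintro rfl
    rw [Subgroup.index_top] at hB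
    norm_num at hB
  obtain ⟨χ₁, h₁⟩ := exists_hom_of_index_two hA
  obtain ⟨χ₂, h₂⟩ := exists_hom_of_index_two hB
  have hy2 : χ₂ y = 1 := (h₂ y).mpr (hyB (Subgroup.mem_zpowers y))
  have hy1 : χ₁ y ≠ 1 := fun h => hy ((h₁ y).mp h)
  refine ⟨χ₁, χ₂, ?_, ?_, ?_⟩
  · rintro rfl
    exact hy1 rfl
  · rintro rfl
    exact hBtop ((Subgroup.eq_top_iff' B).mpr fun x => (h₂ x).mp rfl)
  · rintro rfl
    exact hy1 hy2

/-- Normal form of the elements of a group generated by two involutions. -/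
theorem dihedral_form {G : Type*} [Group G] {a b : G} (ha : a * a = 1) (hb : b * b = 1) {g : G}
    (hg : g ∈ Subgroup.closure {a, b}) : ∃ j : ℤ, g = (a * b) ^ j ∨ g = (a * b) ^ j * a := by
  have hai : a⁻¹ = a := inv_eq_of_mul_eq_one_left ha
  have hbi : b⁻¹ = b := inv_eq_of_mul_eq_one_left hb
  have conj : ∀ j : ℤ, a * (a * b) ^ j = (a * b) ^ (-j) * a := by
    intro j
    have h : a * (a * b) * a⁻¹ = (a * b)⁻¹ := by
      rw [mul_inv_rev, hai, hbi, ← mul_assoc, ha, one_mul]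
    have h2 : a * (a * b) ^ j * a⁻¹ = (a * b) ^ (-j) := by
      rw [← conj_zpow, h, inv_zpow, zpow_neg]
    rw [← h2]
    group
  have hbj : ∀ j : ℤ, b * (a * b) ^ j = (a * b) ^ (-j - 1) * a := by
    intro j
    have : b = (a * b) ^ (-1 : ℤ) * a := by
      rw [zpow_neg_one, mul_inv_rev, hai, hbi, mul_assoc, ha, mul_one]
    calc b * (a * b) ^ j = (a * b) ^ (-1 : ℤ) * (a * (a * b) ^ j) := by
          conv_lhs => rw [this]
          rw [mul_assoc]
          simp only [← this]
      _ = _ := by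
          rw [conj, ← mul_assoc, ← zpow_add]
          congr 2
          ring
  induction hg using Subgroup.closure_induction_left with
  | one => exact ⟨0, Or.inl (by simp)⟩
  | mul_left x hx y hy ih =>
    obtain ⟨j, rfl | rfl⟩ := ih
    · rcases hx with rfl | rfl
      · exact ⟨-j, Or.inr (conj j)⟩
      · exact ⟨-j - 1, Or.inr (hbj j)⟩
    · rcases hx with rfl | rfl
      · exact ⟨-j, Or.inl (by rw [← mul_assoc, conj, mul_assoc, ha, mul_one])⟩
      · exact ⟨-j - 1, Or.inl (by rw [← mul_assoc, hbj, mul_assoc, ha, mul_one])⟩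
  | inv_mul_cancel x hx y hy ih =>
    obtain ⟨j, rfl | rfl⟩ := ih
    · rcases hx with rfl | rfl
      · exact ⟨-j, Or.inr (by rw [hai]; exact conj j)⟩
      · exact ⟨-j - 1, Or.inr (by rw [hbi]; exact hbj j)⟩
    · rcases hx with rfl | rfl
      · exact ⟨-j, Or.inl (by rw [hai, ← mul_assoc, conj, mul_assoc, ha, mul_one])⟩
      · exact ⟨-j - 1, Or.inl (by rw [hbi, ← mul_assoc, hbj, mul_assoc, ha, mul_one])⟩

end Signs

section EvenSets

variable {G P : Type*} [Group G] [Group P]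

theorem mul_self_of_eq_inv {x : G} (h : x = x⁻¹) : x * x = 1 := by
  nth_rewrite 1 [h]
  exact inv_mul_cancel x

theorem ne_inv_of_mul_self_ne {x : G} (h : x * x ≠ 1) : x ≠ x⁻¹ :=
  fun h' => h (mul_self_of_eq_inv h')

theorem exists_sign_pullback [Finite P] (hP : IsPGroup 2 P) (π : G →* P) {A : Subgroup P} {u : G}
    (hu : π u ∉ A) :
    ∃ ε : G → ℤˣ, (∀ g, ∀ a, π a ∈ A → ε (g * a) = ε g) ∧ ∀ g, ε (g * u) = -ε g := by
  obtain ⟨ε, h1, h2⟩ := exists_sign_of_notMem hP hu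
  exact ⟨fun g => ε (π g), fun g a ha => by simp [h1 _ _ ha], fun g => by simp [h2]⟩

theorem involution_notMem_zpowers_mul {s t : P} (hs : s * s = 1) (ht : t * t = 1) (hs1 : s ≠ 1)
    (ht1 : t ≠ 1) : s ∉ Subgroup.zpowers (s * t) := by
  rintro ⟨i, hi⟩
  simp only at hi
  have hc : Commute s (s * t) := by
    have := (Commute.refl (s * t)).zpow_left i
    rwa [hi] at this
  have hst : s * t = t * s := by
    have h := hc.eq
    have h' : s * (s * t) = s * (t * s) := by rw [h, mul_assoc]
    exact mul_left_cancel h'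
  have hsq : (s * t) ^ (2 : ℤ) = 1 := by
    rw [zpow_two]
    calc s * t * (s * t) = s * t * (t * s) := by rw [hst]
      _ = s * (t * t) * s := by group
      _ = 1 := by rw [ht, mul_one, hs]
  rcases Int.even_or_odd' i with ⟨k, rfl | rfl⟩
  · rw [zpow_mul, hsq, one_zpow] at hi
    exact hs1 hi.symm
  · rw [zpow_add, zpow_mul, hsq, one_zpow, one_mul, zpow_one] at hi
    exact ht1 (by simpa using hi)

theorem exists_involution_of_odd_card {Y : Finset G} (hinv : ∀ y ∈ Y, y⁻¹ ∈ Y)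
    (ho : Odd Y.card) : ∃ t ∈ Y, t * t = 1 := by
  by_contra! h
  have := Finset.sum_involution (s := Y) (f := fun _ => (1 : ZMod 2)) (fun y _ => y⁻¹)
    (fun _ _ => by decide) (fun y hy _ => (ne_inv_of_mul_self_ne (h y hy)).symm)
    (fun y hy => hinv y hy) (fun y _ => inv_inv y)
  rw [Finset.sum_const, nsmul_eq_mul, mul_one] at this
  rw [ZMod.natCast_eq_zero_iff_even] at this
  exact (Nat.not_even_iff_odd.mpr ho) this

variable [DecidableEq G]

theorem HasNet.of_sdiff {X Y : Finset G} (h : X ⊆ Y) (hX : HasNet X 0) (hYX : HasNet (Y \ X) 0) :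
    HasNet Y 0 := by
  have := (hYX.union hX Finset.sdiff_disjoint).congr (ψ := 0) (by simp)
  rwa [Finset.sdiff_union_of_subset h] at this

theorem sdiff_inv_closed {X Y : Finset G} (hX : ∀ x ∈ X, x⁻¹ ∈ X) (hY : ∀ y ∈ Y, y⁻¹ ∈ Y) :
    ∀ y ∈ Y \ X, y⁻¹ ∈ Y \ X := by
  intro y hy
  rw [Finset.mem_sdiff] at hy ⊢
  exact ⟨hY y hy.1, fun h => hy.2 (by simpa using hX _ h)⟩

theorem hasNet_of_even [Finite P] (hP : IsPGroup 2 P) (π : G →* P)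
    (hπ : ∀ t, t * t = 1 → t ≠ 1 → π t ≠ 1) :
    ∀ (n : ℕ) (Y : Finset G), Y.card = n → 1 ∉ Y → (∀ y ∈ Y, y⁻¹ ∈ Y) → Even Y.card →
      HasNet Y 0 := by
  intro n
  induction n using Nat.strong_induction_on with
  | _ n ih =>
    intro Y hn h1 hinv he
    rcases Y.eq_empty_or_nonempty with rfl | hne
    · exact hasNet_empty
    have step : ∀ Z : Finset G, Z ⊆ Y → Z.card = 2 → HasNet Z 0 → HasNet Y 0 := by
      intro Z hZ hZ2 hZn
      have hle := Finset.card_le_card hZ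
      have hc := Finset.card_sdiff_of_subset hZ
      refine hZn.of_sdiff hZ (ih (Y \ Z).card (by omega) _ rfl
        (fun h => h1 (Finset.sdiff_subset h)) (sdiff_inv_closed hZn.1 hinv) ?_)
      rw [hc, hZ2]
      rw [Nat.even_sub (by omega)]
      simp [he]
    by_cases hw : ∃ w ∈ Y, w * w ≠ 1
    · obtain ⟨w, hwY, hw⟩ := hw
      have hww := ne_inv_of_mul_self_ne hw
      refine step {w, w⁻¹} ?_ (Finset.card_pair hww)
        ((hasNet_pair hww (fun _ => 1) (by simp)).congr (by simp))
      simp [Finset.insert_subset_iff, hwY, hinv w hwY]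
    · push Not at hw
      have h2 : 1 < Y.card := by
        obtain ⟨k, hk⟩ := he
        have := hne.card_pos
        omega
      obtain ⟨s, hs, t, ht, hst⟩ := Finset.one_lt_card.mp h2
      have hs1 : s ≠ 1 := fun h => h1 (h ▸ hs)
      have ht1 : t ≠ 1 := fun h => h1 (h ▸ ht)
      have hsb := hπ s (hw s hs) hs1
      have htb := hπ t (hw t ht) ht1
      have hss : π s * π s = 1 := by rw [← map_mul, hw s hs, map_one]
      have htt : π t * π t = 1 := by rw [← map_mul, hw t ht, map_one]
      obtain ⟨ε, e1, e2⟩ :=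
        exists_sign_pullback hP π (involution_notMem_zpowers_mul hss htt hsb htb)
      refine step {s, t} ?_ (Finset.card_pair hst)
        (hasNet_two_involutions (hw s hs) (hw t ht) hst ε e2 fun g => ?_)
      · simp [Finset.insert_subset_iff, hs, ht]
      · have := e1 (g * s) (s * t) (by rw [map_mul]; exact Subgroup.mem_zpowers _)
        rw [← e2, ← this, ← mul_assoc, mul_assoc g s s, hw s hs, mul_one]

theorem HasNet.extend [Finite P] (hP : IsPGroup 2 P) (π : G →* P)
    (hπ : ∀ t, t * t = 1 → t ≠ 1 → π t ≠ 1) {X Y : Finset G} (h : X ⊆ Y) (hX : HasNet X 0)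
    (h1 : 1 ∉ Y) (hinv : ∀ y ∈ Y, y⁻¹ ∈ Y) (hXo : Odd X.card) (hYo : Odd Y.card) :
    HasNet Y 0 := by
  refine hX.of_sdiff h (hasNet_of_even hP π hπ _ _ rfl (fun h' => h1 (Finset.sdiff_subset h'))
    (sdiff_inv_closed hX.1 hinv) ?_)
  rw [Finset.card_sdiff_of_subset h]
  exact Nat.Odd.sub_odd hYo hXo

end EvenSets

section CentralInvolution

variable {H : Type*} [Group H] [Fintype H]

theorem sum_eq_zero_of_translate (χ : H →* ℤˣ) {y : H} (hy : χ y = -1) (F : H → ZMod 2)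
    (hF : ∀ g, χ g = 1 → F (y * g) = F g) : ∑ g, F g = 0 := by
  have hneg : (-1 : ℤˣ) ≠ 1 := by decide
  have hF' : ∀ g, χ g ≠ 1 → F (y⁻¹ * g) = F g := by
    intro g hg
    have h := hF (y⁻¹ * g) (by simp [hy, (Int.units_eq_one_or (χ g)).resolve_left hg])
    rw [← h, mul_inv_cancel_left]
  have hy1 : y ≠ 1 := by
    rintro rfl
    simp at hy
  refine Finset.sum_involution (fun g _ => if χ g = 1 then y * g else y⁻¹ * g) ?_ ?_ (by simp) ?_
  · intro g _
    by_cases h : χ g = 1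
    · simp only [h, if_true, hF g h, CharTwo.add_self_eq_zero]
    · simp only [h, if_false, hF' g h, CharTwo.add_self_eq_zero]
  · intro g _ _
    by_cases h : χ g = 1 <;> simp [h, hy1]
  · intro g _
    by_cases h : χ g = 1
    · simp [h, hy, hneg]
    · simp [hy, (Int.units_eq_one_or (χ g)).resolve_left h]

theorem sum_eq_zero_of_invariant {z : H} (hz : z * z = 1) (hz1 : z ≠ 1) (F : H → ZMod 2)
    (hF : ∀ g, F (g * z) = F g) : ∑ g, F g = 0 := by
  refine Finset.sum_involution (fun g _ => g * z) ?_ ?_ (by simp) ?_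
  · intro g _
    simp only [hF, CharTwo.add_self_eq_zero]
  · intro g _ _
    simpa using hz1
  · intro g _
    simp [mul_assoc, hz]

theorem exists_antisymmetric {z : H} (hz : z * z = 1) (hz1 : z ≠ 1) :
    ∃ u : H → ZMod 2, ∀ g, u (g * z) = u g + 1 := by
  classical
  let e := Fintype.equivFin H
  refine ⟨fun g => if e g < e (g * z) then 0 else 1, fun g => ?_⟩
  have hne : e (g * z) ≠ e g := by simpa using hz1
  simp only [mul_assoc, hz, mul_one]
  rcases lt_or_gt_of_ne hne with h | h
  · simp [h, not_lt_of_gt h, CharTwo.add_self_eq_zero]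
  · simp [h, not_lt_of_gt h]

theorem exists_antisymmetric_sum_zero {x y z : H} (hz : z * z = 1) (hz1 : z ≠ 1)
    (χ : H →* ℤˣ) (hx : χ x = 1) (hy : χ y = -1) (hχz : χ z = 1) :
    ∃ u : H → ZMod 2, (∀ g, u (g * z) = u g + 1) ∧ ∑ g, u g = 0 ∧
      ∑ g, u g * (u g + u (g * x⁻¹)) = 0 := by
  classical
  obtain ⟨u, hu⟩ := exists_antisymmetric hz hz1
  have hneg : (-1 : ℤˣ) ≠ 1 := by decide
  have key : ∀ g, χ g = 1 →
      (if χ (y * g) = 1 then u (y * g) else u (y⁻¹ * (y * g))) =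
        if χ g = 1 then u g else u (y⁻¹ * g) := by
    intro g hg
    simp [hg, hy, hneg]
  refine ⟨fun g => if χ g = 1 then u g else u (y⁻¹ * g), fun g => ?_, ?_, ?_⟩
  · by_cases h : χ g = 1 <;> simp [h, hχz, hu, ← mul_assoc]
  · exact sum_eq_zero_of_translate χ hy _ key
  · refine sum_eq_zero_of_translate χ hy _ fun g hg => ?_
    have h1 := key g hg
    have h2 := key (g * x⁻¹) (by simp [hg, hx])
    rw [← mul_assoc] at h2
    simp only [h1, h2]

theorem exists_antisymmetric_pair {x y z : H} (hgen : Subgroup.closure {x, y} = ⊤)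
    (hz : z * z = 1) (hz1 : z ≠ 1) (hzx : z ∈ Subgroup.zpowers x) (hzy : z ∈ Subgroup.zpowers y)
    (χ₁ χ₂ : H →* ℤˣ) (h1x : χ₁ x = -1) (h1y : χ₁ y = 1) (h2x : χ₂ x = 1) (h2y : χ₂ y = -1) :
    ∃ u v : H → ZMod 2, (∀ g, u (g * z) = u g + 1) ∧ (∀ g, v (g * z) = v g + 1) ∧
      ∀ g, u g + u (g * x⁻¹) + (v g + v (g * y⁻¹)) = 1 := by
  classical
  have cx : Commute z x := by
    obtain ⟨i, rfl⟩ := hzx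
    exact (Commute.refl x).zpow_left i
  have cy : Commute z y := by
    obtain ⟨i, rfl⟩ := hzy
    exact (Commute.refl y).zpow_left i
  have hz1' : χ₁ z = 1 := by
    obtain ⟨i, rfl⟩ := hzy
    simp [h1y]
  have hz2' : χ₂ z = 1 := by
    obtain ⟨i, rfl⟩ := hzx
    simp [h2x]
  obtain ⟨u, hu, hus, hux⟩ := exists_antisymmetric_sum_zero hz hz1 χ₂ h2x h2y hz2'
  obtain ⟨v, hv, hvs, hvy⟩ := exists_antisymmetric_sum_zero hz hz1 χ₁ h1y h1x hz1'
  have shx : ∀ g, g * z * x⁻¹ = g * x⁻¹ * z := fun g => by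
    rw [mul_assoc, cx.inv_right.eq, mul_assoc]
  have shy : ∀ g, g * z * y⁻¹ = g * y⁻¹ * z := fun g => by
    rw [mul_assoc, cy.inv_right.eq, mul_assoc]
  let I : Submodule (ZMod 2) (H → ZMod 2) :=
    { carrier := {r | ∃ α β : H → ZMod 2, (∀ g, α (g * z) = α g) ∧ (∀ g, β (g * z) = β g) ∧
        ∀ g, α g + α (g * x⁻¹) + (β g + β (g * y⁻¹)) = r g}
      zero_mem' := ⟨0, 0, by simp, by simp, by simp⟩
      add_mem' := by
        rintro r s ⟨α, β, h1, h2, h3⟩ ⟨α', β', h1', h2', h3'⟩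
        refine ⟨α + α', β + β', by simp [h1, h1'], by simp [h2, h2'], fun g => ?_⟩
        simp only [Pi.add_apply, ← h3, ← h3']
        ring
      smul_mem' := by
        rintro c r ⟨α, β, h1, h2, h3⟩
        refine ⟨c • α, c • β, by simp [h1], by simp [h2], fun g => ?_⟩
        simp only [Pi.smul_apply, ← h3, smul_eq_mul]
        ring }
  let δ : H → H → ZMod 2 := fun h g => (if g = h then 1 else 0) + if g = h * z then 1 else 0
  have hδz : ∀ h g, δ h (g * z) = δ h g := by
    intro h g
    have e1 : g * z = h ↔ g = h * z := by
      constructor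
      · rintro rfl
        simp [mul_assoc, hz]
      · rintro rfl
        simp [mul_assoc, hz]
    simp only [δ, e1, mul_left_inj]
    rw [add_comm]
  have hδx : ∀ h, δ h + δ (h * x) ∈ I := by
    intro h
    refine ⟨δ h, 0, hδz h, by simp, fun g => ?_⟩
    have : h * x * z = h * z * x := by rw [mul_assoc, ← cx.eq, mul_assoc]
    simp [δ, this, mul_inv_eq_iff_eq_mul]
  have hδy : ∀ h, δ h + δ (h * y) ∈ I := by
    intro h
    refine ⟨0, δ h, by simp, hδz h, fun g => ?_⟩
    have : h * y * z = h * z * y := by rw [mul_assoc, ← cy.eq, mul_assoc]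
    simp [δ, this, mul_inv_eq_iff_eq_mul]
  have hδ : ∀ k h, δ h + δ (h * k) ∈ I := by
    intro k
    have hk : k ∈ Subgroup.closure {x, y} := hgen ▸ Subgroup.mem_top k
    induction hk using Subgroup.closure_induction with
    | mem k hk =>
      rcases hk with rfl | rfl
      · exact hδx
      · exact hδy
    | one =>
      intro h
      rw [mul_one, CharTwo.add_self_eq_zero]
      exact I.zero_mem
    | mul k l _ _ hk hl =>
      intro h
      have := I.add_mem (hk h) (hl (h * k))
      rw [← mul_assoc]
      convert this using 1
      funext g
      simp only [Pi.add_apply]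
      linear_combination -(CharTwo.add_self_eq_zero (δ (h * k) g))
    | inv k _ hk =>
      intro h
      have := hk (h * k⁻¹)
      rwa [inv_mul_cancel_right, add_comm] at this
  have hI : ∀ r : H → ZMod 2, (∀ g, r (g * z) = r g) → ∑ g, u g * r g = 0 → r ∈ I := by
    intro r hr hs
    have hsum : r = ∑ h, (u h * r h) • (δ h + δ 1) := by
      funext g
      simp only [Finset.sum_apply, Pi.smul_apply, Pi.add_apply, smul_eq_mul, mul_add,
        Finset.sum_add_distrib]
      rw [← Finset.sum_mul, hs, zero_mul, add_zero]
      have e1 : ∀ h : H, g = h * z ↔ h = g * z := by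
        intro h
        constructor
        · rintro rfl
          simp [mul_assoc, hz]
        · rintro rfl
          simp [mul_assoc, hz]
      simp only [δ, mul_add, e1, Finset.sum_add_distrib]
      simp only [mul_ite, mul_one, mul_zero, Finset.sum_ite_eq, Finset.sum_ite_eq',
        Finset.mem_univ, if_true, hu, hr]
      linear_combination -(CharTwo.add_self_eq_zero (u g * r g))
    rw [hsum]
    refine I.sum_mem fun h _ => I.smul_mem _ ?_
    have := hδ h 1
    rwa [one_mul, add_comm] at this
  have hr := hI (fun g => 1 + (u g + u (g * x⁻¹)) + (v g + v (g * y⁻¹))) ?_ ?_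
  · obtain ⟨α, β, hα, hβ, h⟩ := hr
    refine ⟨u + α, v + β, fun g => ?_, fun g => ?_, fun g => ?_⟩
    · simp only [Pi.add_apply, hu, hα]
      ring
    · simp only [Pi.add_apply, hv, hβ]
      ring
    · simp only [Pi.add_apply]
      linear_combination h g + CharTwo.add_self_eq_zero (u g + u (g * x⁻¹) + v g + v (g * y⁻¹))
  · intro g
    simp only [hu, hv, shx, shy]
    linear_combination 2 * CharTwo.add_self_eq_zero (1 : ZMod 2)
  · have e : ∑ g, (u g + v g) * (v g + v (g * y⁻¹)) = 0 := by
      refine sum_eq_zero_of_invariant hz hz1 _ fun g => ?_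
      simp only [hu, hv, shy]
      linear_combination (v g + v (g * y⁻¹) + u g + v g + 2) * CharTwo.add_self_eq_zero (1 : ZMod 2)
    have e' : ∑ g, (u g + v g) * (v g + v (g * y⁻¹)) =
        ∑ g, u g * (v g + v (g * y⁻¹)) + ∑ g, v g * (v g + v (g * y⁻¹)) := by
      rw [← Finset.sum_add_distrib]
      exact Finset.sum_congr rfl fun g _ => by ring
    rw [e', hvy, add_zero] at e
    simp only [mul_add, Finset.sum_add_distrib, mul_one, hus, zero_add] at hux e ⊢
    rw [hux, e, add_zero]

end CentralInvolution

theorem exists_antisymmetric_pair_pullback {G P : Type*} [Group G] [Group P] [Finite P]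
    (π : G →* P) {x y z : G} (hz : z * z = 1) (hz1 : π z ≠ 1)
    (hzx : π z ∈ Subgroup.zpowers (π x)) (hzy : π z ∈ Subgroup.zpowers (π y))
    (χ₁ χ₂ : P →* ℤˣ) (h1x : χ₁ (π x) = -1) (h1y : χ₁ (π y) = 1) (h2x : χ₂ (π x) = 1)
    (h2y : χ₂ (π y) = -1) :
    ∃ u v : G → ZMod 2, (∀ g, u (g * z) = u g + 1) ∧ (∀ g, v (g * z) = v g + 1) ∧
      (∀ g, u g + u (g * x⁻¹) + (v g + v (g * y⁻¹)) = 1) ∧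
      (∀ g, u (g * z * x⁻¹) = u (g * x⁻¹) + 1) ∧ ∀ g, v (g * z * y⁻¹) = v (g * y⁻¹) + 1 := by
  let H := Subgroup.closure {π x, π y}
  have hx : π x ∈ H := Subgroup.subset_closure (by simp)
  have hy : π y ∈ H := Subgroup.subset_closure (by simp)
  have hzH : π z ∈ H := (Subgroup.zpowers_le.mpr hx) hzx
  have : Fintype H := Fintype.ofFinite H
  have mz : ∀ {w : P} (hw : w ∈ H), π z ∈ Subgroup.zpowers w →
      (⟨π z, hzH⟩ : H) ∈ Subgroup.zpowers (⟨w, hw⟩ : H) := by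
    rintro w hw ⟨i, hi⟩
    exact ⟨i, Subtype.ext (by simpa using hi)⟩
  obtain ⟨u, v, hu, hv, huv⟩ := exists_antisymmetric_pair (H := H) (x := ⟨π x, hx⟩)
    (y := ⟨π y, hy⟩) (z := ⟨π z, hzH⟩) (by
      have := Subgroup.closure_closure_coe_preimage (k := ({π x, π y} : Set P))
      rw [← this]
      congr 1
      ext ⟨g, hg⟩
      simp)
    (Subtype.ext (by simp [← map_mul, hz])) (fun h => hz1 (congrArg Subtype.val h))
    (mz hx hzx) (mz hy hzy) (χ₁.comp H.subtype) (χ₂.comp H.subtype) (by simpa) (by simpa)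
    (by simpa) (by simpa)
  obtain ⟨ρ, hρ⟩ := exists_right_equivariant H
  have eρ : ∀ g w (hw : π w ∈ H), ρ (π (g * w)) = ρ (π g) * ⟨π w, hw⟩ := fun g w hw => by
    rw [map_mul]
    exact hρ (π g) ⟨π w, hw⟩
  have ex : ∀ g, ρ (π (g * x⁻¹)) = ρ (π g) * (⟨π x, hx⟩ : H)⁻¹ := fun g => by
    rw [eρ g x⁻¹ (by simpa using hx)]
    exact congrArg _ (Subtype.ext (by simp))
  have ey : ∀ g, ρ (π (g * y⁻¹)) = ρ (π g) * (⟨π y, hy⟩ : H)⁻¹ := fun g => by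
    rw [eρ g y⁻¹ (by simpa using hy)]
    exact congrArg _ (Subtype.ext (by simp))
  have sx : ∀ g, ρ (π (g * z * x⁻¹)) = ρ (π (g * x⁻¹)) * ⟨π z, hzH⟩ := fun g => by
    obtain ⟨i, hi⟩ := mz hx hzx
    rw [ex, ex, eρ g z hzH, ← hi]
    group
  have sy : ∀ g, ρ (π (g * z * y⁻¹)) = ρ (π (g * y⁻¹)) * ⟨π z, hzH⟩ := fun g => by
    obtain ⟨i, hi⟩ := mz hy hzy
    rw [ey, ey, eρ g z hzH, ← hi]
    group
  have huv' : ∀ g, u (ρ (π g)) + u (ρ (π (g * x⁻¹))) +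
      (v (ρ (π g)) + v (ρ (π (g * y⁻¹)))) = 1 := fun g => by
    rw [ex, ey]
    exact huv _
  refine ⟨fun g => u (ρ (π g)), fun g => v (ρ (π g)), fun g => ?_, fun g => ?_, fun g => ?_,
    fun g => ?_, fun g => ?_⟩
  · simp only [eρ g z hzH, hu]
  · simp only [eρ g z hzH, hv]
  · exact huv' g
  · simp only [sx, hu]
  · simp only [sy, hv]

theorem hasNet_two_pairs_involution {G P : Type*} [Group G] [Group P] [DecidableEq G] [Finite P]
    (π : G →* P) {x y z : G} (hx : x * x ≠ 1) (hy : y * y ≠ 1) (hz : z * z = 1) (hz1 : π z ≠ 1)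
    (hzx : π z ∈ Subgroup.zpowers (π x)) (hzy : π z ∈ Subgroup.zpowers (π y))
    (χ₁ χ₂ : P →* ℤˣ) (h1x : χ₁ (π x) = -1) (h1y : χ₁ (π y) = 1) (h2x : χ₂ (π x) = 1)
    (h2y : χ₂ (π y) = -1) :
    HasNet ({x, x⁻¹} ∪ {y, y⁻¹} ∪ {z}) 0 := by
  obtain ⟨u, v, hu, hv, huv, hux, hvy⟩ :=
    exists_antisymmetric_pair_pullback π hz hz1 hzx hzy χ₁ χ₂ h1x h1y h2x h2y
  let s : ZMod 2 → ℤ := fun a => if a = 0 then 1 else -1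
  have s1 : ∀ a, s (a + 1) = -s a := by decide
  have s3 : ∀ a, 0 < |s a| ∧ |s a| < 3 := by decide
  have s4 : ∀ a b c d : ZMod 2, a + b + (c + d) = 1 →
      0 < |s a - s b + (s c - s d)| ∧ |s a - s b + (s c - s d)| < 3 := by decide
  have zi : z⁻¹ = z := inv_eq_of_mul_eq_one_left hz
  have hneg : (-1 : ℤˣ) ≠ 1 := by decide
  have hxx := ne_inv_of_mul_self_ne hx
  have hyy := ne_inv_of_mul_self_ne hy
  have yx : y ≠ x := by
    rintro rfl
    exact hneg (h1x.symm.trans h1y)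
  have yx' : y ≠ x⁻¹ := by
    rintro rfl
    simp [h1x, hneg] at h1y
  have zx : z ≠ x := fun h => hx (h ▸ hz)
  have zy : z ≠ y := fun h => hy (h ▸ hz)
  have zx' : z ≠ x⁻¹ := fun h => zx (by rw [← zi, h, inv_inv])
  have zy' : z ≠ y⁻¹ := fun h => zy (by rw [← zi, h, inv_inv])
  have A := hasNet_pair hxx (fun g => s (u g)) fun g => s3 _
  have B := hasNet_pair hyy (fun g => s (v g)) fun g => s3 _
  have C := hasNet_single hz
    (fun g => -(s (u g) - s (u (g * x⁻¹)) + (s (v g) - s (v (g * y⁻¹)))))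
    (fun g => by simp only [hu, hv, hux, hvy, s1]; ring)
    (fun g => by simpa only [abs_neg] using s4 _ _ _ _ (huv g))
  refine ((A.union B ?_).union C ?_).congr fun g => ?_
  · simp [yx, yx', inv_eq_iff_eq_inv]
  · simp [zx, zy, zx', zy']
  · simp only [Pi.add_apply, Pi.zero_apply]
    ring

section OddNormalSubgroup

theorem eq_one_of_mul_self_of_odd_orderOf {K : Type*} [Group K] {w : K} (hw : w * w = 1)
    (ho : Odd (orderOf w)) : w = 1 := by
  rw [← orderOf_eq_one_iff]
  have h2 : orderOf w ∣ 2 := orderOf_dvd_of_pow_eq_one (by rw [pow_two, hw])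
  rcases (Nat.dvd_prime Nat.prime_two).mp h2 with h | h
  · exact h
  · rw [h] at ho
    exact absurd ho (by decide)

theorem notMem_closure_involutions {K : Type*} [Group K] {b z w : K} (hb : b * b = 1)
    (hz : z * z = 1) (hzw : Commute z w) (ho : Odd (orderOf w)) (hw1 : w ≠ 1) :
    w ∉ Subgroup.closure {b, z} := by
  intro hmem
  have hbi : b⁻¹ = b := inv_eq_of_mul_eq_one_left hb
  have hzi : z⁻¹ = z := inv_eq_of_mul_eq_one_left hz
  refine hw1 (eq_one_of_mul_self_of_odd_orderOf ?_ ho)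
  obtain ⟨j, hj | hj⟩ := dihedral_form hb hz hmem
  · have h1 : z * w * z⁻¹ = w⁻¹ := by
      rw [hj, ← conj_zpow, ← inv_zpow]
      congr 1
      rw [mul_inv_rev, hbi, mul_assoc, mul_assoc, mul_inv_cancel, mul_one, hzi]
    rw [hzw.eq, mul_inv_cancel_right] at h1
    exact mul_self_of_eq_inv h1
  · have h1 : b * (b * z) ^ j * b⁻¹ = (b * z) ^ (-j) := by
      rw [← conj_zpow, zpow_neg, ← inv_zpow]
      congr 1
      rw [mul_inv_rev, hzi, hbi, ← mul_assoc, hb, one_mul]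
    calc w * w = (b * z) ^ j * (b * (b * z) ^ j * b⁻¹) := by
          rw [hbi, hj]
          group
      _ = 1 := by rw [h1, ← zpow_add, add_neg_cancel, zpow_zero]

theorem exists_nonconstant_sign {K : Type*} [Group K] [Finite K] {B : Subgroup K} {w : K}
    (hn : (Subgroup.zpowers w).Normal) (hw : w ∉ B) :
    ∃ μ : K → ℤˣ, (∀ g, ∀ h ∈ B, μ (g * h) = μ g) ∧
      ∀ g s, ∃ i : ℕ, μ (g * (w ^ i)⁻¹) = s := by
  classical
  obtain ⟨ρ, hρ⟩ := exists_right_equivariant (B ⊔ Subgroup.zpowers w)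
  have hB : B ≤ B ⊔ Subgroup.zpowers w := le_sup_left
  have hW : Subgroup.zpowers w ≤ B ⊔ Subgroup.zpowers w := le_sup_right
  have hρ' : ∀ g h, h ∈ B ⊔ Subgroup.zpowers w → (ρ (g * h) : K) = ρ g * h := fun g h hh => by
    rw [hρ g ⟨h, hh⟩]
    rfl
  have hpow : ∀ h ∈ Subgroup.zpowers w, ∃ i : ℕ, h = (w ^ i)⁻¹ := by
    intro h hh
    obtain ⟨i, hi⟩ := (mem_powers_iff_mem_zpowers).mpr (inv_mem hh)
    exact ⟨i, by simp only at hi; rw [hi, inv_inv]⟩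
  refine ⟨fun g => if (ρ g : K) ∈ B then 1 else -1, fun g h hh => ?_, fun g s => ?_⟩
  · simp only [hρ' g h (hB hh), B.mul_mem_cancel_right hh]
  · obtain ⟨β, hβ, ω, hω, hg⟩ := Subgroup.mem_sup_of_normal_right.mp (ρ g).2
    rcases Int.units_eq_one_or s with rfl | rfl
    · obtain ⟨i, hi⟩ := hpow _ (inv_mem hω)
      refine ⟨i, ?_⟩
      simp only [← hi, hρ' _ _ (hW (inv_mem hω)), ← hg]
      simp [hβ]
    · have hm : ω⁻¹ * w ∈ Subgroup.zpowers w := mul_mem (inv_mem hω) (Subgroup.mem_zpowers w)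
      obtain ⟨i, hi⟩ := hpow _ hm
      refine ⟨i, ?_⟩
      simp only [← hi, hρ' _ _ (hW hm), ← hg]
      simp [mul_assoc, B.mul_mem_cancel_left hβ, hw]

theorem exists_flow_functions {K : Type*} [Group K] [Finite K] {b z w : K} (hb : b * b = 1)
    (hz : z * z = 1) (hzw : Commute z w) (ho : Odd (orderOf w)) (hw1 : w ≠ 1)
    (hn : (Subgroup.zpowers w).Normal) (f χ : K → ℤˣ) (fz : ∀ g, f (g * z) = -f g)
    (fw : ∀ g, f (g * w) = f g) (χb : ∀ g, χ (g * b) = -χ g) (χz : ∀ g, χ (g * z) = -χ g)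
    (χw : ∀ g, χ (g * w) = χ g) :
    ∃ (h : K → ℤˣ) (k : K → ℤ), (∀ g, h (g * b) = -h g) ∧ (∀ g, h (g * z) = -h g) ∧
      (∀ g, k (g * z) = -k g) ∧ (∀ g, 0 < |k g| ∧ |k g| < 3) ∧
      ∀ g, 0 < |f g + h g + (k g - k (g * w⁻¹))| ∧ |f g + h g + (k g - k (g * w⁻¹))| < 3 := by
  classical
  obtain ⟨μ, hμ, hμs⟩ :=
    exists_nonconstant_sign hn (notMem_closure_involutions hb hz hzw ho hw1)
  have μb : ∀ g, μ (g * b) = μ g := fun g => hμ g b (Subgroup.subset_closure (by simp))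
  have μz : ∀ g, μ (g * z) = μ g := fun g => hμ g z (Subgroup.subset_closure (by simp))
  have fwi : ∀ g, f (g * w⁻¹) = f g := fun g => by rw [← fw, inv_mul_cancel_right]
  have χwi : ∀ g, χ (g * w⁻¹) = χ g := fun g => by rw [← χw, inv_mul_cancel_right]
  have pinv : ∀ (φ : K → ℤˣ), (∀ g, φ (g * w⁻¹) = φ g) → ∀ g (i : ℕ), φ (g * (w ^ i)⁻¹) = φ g := by
    intro φ hφ g i
    induction i with
    | zero => simp
    | succ i ih => rw [pow_succ', mul_inv_rev, ← mul_assoc, hφ, ih]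
  let T : K → Prop := fun g => f g = χ g * μ g
  have hT : ∀ g, ∃ i : ℕ, T (g * (w ^ i)⁻¹) := by
    intro g
    obtain ⟨i, hi⟩ := hμs g (χ g * f g)
    refine ⟨i, ?_⟩
    simp only [T, pinv f fwi, pinv χ χwi, hi, ← mul_assoc, Int.units_mul_self, one_mul]
  let ind : K → ℕ := fun g => Nat.find (hT g)
  have ind0 : ∀ g, T g → ind g = 0 := fun g hg => by
    rw [Nat.find_eq_zero]
    simpa using hg
  have indS : ∀ g, ¬ T g → ind g = ind (g * w⁻¹) + 1 := by
    intro g hg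
    have e : ∀ n : ℕ, g * (w ^ (n + 1))⁻¹ = g * w⁻¹ * (w ^ n)⁻¹ := fun n => by
      rw [pow_succ, mul_inv_rev, mul_assoc]
    have h2 : ∃ n : ℕ, T (g * (w ^ (n + 1))⁻¹) := by
      obtain ⟨n, hn⟩ := hT (g * w⁻¹)
      exact ⟨n, by rwa [e]⟩
    have := Nat.find_comp_succ (hT g) h2 (by simpa using hg)
    rw [show ind g = _ from this]
    congr 1
    exact Nat.find_congr' (by simp [e])
  have Tz : ∀ g, T (g * z) ↔ T g := fun g => by simp [T, fz, χz, μz]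
  have indz : ∀ g, ind (g * z) = ind g := by
    intro g
    refine Nat.find_congr' fun {n} => ?_
    rw [mul_assoc, ((hzw.pow_right n).inv_right).eq, ← mul_assoc, Tz]
  let e : K → ℤ := fun g => if Even (ind g) then 1 else 2
  have he : ∀ g, e g = 1 ∨ e g = 2 := fun g => by
    by_cases h : Even (ind g) <;> simp [e, h]
  have heT : ∀ g, T g → e g = 1 := fun g hg => by simp [e, ind0 g hg]
  have heS : ∀ g, ¬ T g → e g - e (g * w⁻¹) = 1 ∨ e g - e (g * w⁻¹) = -1 := fun g hg => by
    simp only [e, indS g hg, Nat.even_add_one]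
    by_cases h : Even (ind (g * w⁻¹)) <;> simp [h]
  refine ⟨fun g => χ g * μ g, fun g => f g * e g, fun g => ?_, fun g => ?_, fun g => ?_,
    fun g => ?_, fun g => ?_⟩
  · simp [χb, μb]
  · simp [χz, μz]
  · simp only [fz, e, indz, Units.val_neg, neg_mul]
  · rcases intUnit_cases (f g) with h | h <;> rcases he g with h' | h' <;> simp [h, h']
  · simp only [fwi]
    by_cases hg : T g
    · rw [← show f g = χ g * μ g from hg, heT g hg]
      rcases intUnit_cases (f g) with h | h <;> rcases he (g * w⁻¹) with h' | h' <;>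
        simp [h, h']
    · have hneg : χ g * μ g = -f g := by
        have : f g ≠ χ g * μ g := hg
        rcases Int.units_eq_one_or (f g) with h | h <;>
          rcases Int.units_eq_one_or (χ g * μ g) with h' | h' <;> simp_all
      rw [hneg, ← mul_sub]
      rcases intUnit_cases (f g) with h | h <;> rcases heS g hg with h' | h' <;>
        simp [h, h']

theorem hasNet_three_involutions_pair {G K : Type*} [Group G] [Group K] [Finite K]
    [DecidableEq G] (ρ : G →* K) {a b z w : G} (ha : a * a = 1) (hb : b * b = 1)
    (hz : z * z = 1) (hab : a ≠ b) (haz : a ≠ z) (hbz : b ≠ z) (hw : w * w ≠ 1)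
    (hzw : Commute (ρ z) (ρ w)) (ho : Odd (orderOf (ρ w))) (hw1 : ρ w ≠ 1)
    (hn : (Subgroup.zpowers (ρ w)).Normal) (f χ : K → ℤˣ) (fa : ∀ g, f (g * ρ a) = -f g)
    (fz : ∀ g, f (g * ρ z) = -f g)
    (fw : ∀ g, f (g * ρ w) = f g) (χb : ∀ g, χ (g * ρ b) = -χ g)
    (χz : ∀ g, χ (g * ρ z) = -χ g) (χw : ∀ g, χ (g * ρ w) = χ g) :
    HasNet ({a} ∪ {b} ∪ {w, w⁻¹} ∪ {z}) 0 := by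
  obtain ⟨h, k, hb', hz', kz, ks, hs⟩ := exists_flow_functions (b := ρ b) (z := ρ z) (w := ρ w)
    (by rw [← map_mul, hb, map_one]) (by rw [← map_mul, hz, map_one]) hzw ho hw1 hn f χ fz fw
    χb χz χw
  have hww := ne_inv_of_mul_self_ne hw
  have hne : ∀ t : G, t * t = 1 → t ≠ w ∧ t ≠ w⁻¹ := by
    intro t ht
    refine ⟨fun e => hw (e ▸ ht), fun e => hw ?_⟩
    have hti : t⁻¹ = t := inv_eq_of_mul_eq_one_left ht
    have : t = w := by rw [← hti, e, inv_inv]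
    exact this ▸ ht
  have A := hasNet_single ha (fun g => (f (ρ g) : ℤ)) (fun g => by simp [fa])
    fun g => small_intUnit _
  have B := hasNet_single hb (fun g => (h (ρ g) : ℤ)) (fun g => by simp [hb'])
    fun g => small_intUnit _
  have W := hasNet_pair hww (fun g => k (ρ g)) fun g => ks _
  have Z := hasNet_single hz
    (fun g => -((f (ρ g) : ℤ) + h (ρ g) + (k (ρ g) - k (ρ g * (ρ w)⁻¹))))
    (fun g => by
      simp only [map_mul, fz, hz', kz, Units.val_neg]
      rw [mul_assoc, hzw.inv_right.eq, ← mul_assoc, kz]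
      ring)
    (fun g => by simpa only [abs_neg] using hs _)
  refine (((A.union B ?_).union W ?_).union Z ?_).congr fun g => ?_
  · simpa using hab
  · simp [(hne a ha).1.symm, (hne b hb).1.symm, (hne a ha).2.symm, (hne b hb).2.symm]
  · simp [haz.symm, hbz.symm, (hne z hz).1, (hne z hz).2]
  · simp only [Pi.add_apply, Pi.zero_apply, map_mul, map_inv]
    ring

end OddNormalSubgroup

section Supersolvable

/-- An ascending series of normal subgroups of `G` of length `n` with cyclic factors. -/
structure IsCyclicSeries {G : Type*} [Group G] (n : ℕ) (c : ℕ → Subgroup G) : Prop where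
  normal : ∀ i, (c i).Normal
  le_succ : ∀ i, c i ≤ c (i + 1)
  zero : c 0 = ⊥
  last : c n = ⊤
  cyclic : ∀ i < n, ∃ y ∈ c (i + 1), ∀ x ∈ c (i + 1), ∃ k : ℤ, (y ^ k)⁻¹ * x ∈ c i

theorem IsSupersolvable.exists_series {G : Type*} [Group G] (h : IsSupersolvable G) :
    ∃ (n : ℕ) (c : ℕ → Subgroup G), IsCyclicSeries n c := by
  obtain ⟨n, c, hc, hmono, h0, hn, hcyc⟩ := h
  refine ⟨n, fun i => c ⟨min i n, by omega⟩, fun i => hc _, fun i => hmono ?_, ?_, ?_, ?_⟩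
  · simp only [Fin.mk_le_mk]
    omega
  · simpa using h0
  · simpa [Fin.last] using hn
  · intro i hi
    have e1 : (⟨min i n, by omega⟩ : Fin (n + 1)) = Fin.castSucc ⟨i, hi⟩ := by
      ext
      simp [hi.le]
    have e2 : (⟨min (i + 1) n, by omega⟩ : Fin (n + 1)) = Fin.succ ⟨i, hi⟩ := by
      ext
      simp [Nat.succ_le_of_lt hi]
    simp only [e1, e2]
    have := hc (Fin.castSucc ⟨i, hi⟩)
    obtain ⟨⟨-, y, hy, rfl⟩, hgen⟩ := (hcyc ⟨i, hi⟩).exists_generator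
    refine ⟨y, hy, fun x hx => ?_⟩
    obtain ⟨k, hk⟩ := hgen ⟨QuotientGroup.mk' _ x, x, hx, rfl⟩
    refine ⟨k, ?_⟩
    rw [← QuotientGroup.eq]
    simpa using congrArg Subtype.val hk

theorem IsCyclicSeries.quotient {G : Type*} [Group G] {n : ℕ} {c : ℕ → Subgroup G}
    (h : IsCyclicSeries (n + 1) c) [(c 1).Normal] :
    IsCyclicSeries n fun i => (c (i + 1)).map (QuotientGroup.mk' (c 1)) where
  normal i := (h.normal _).map _ (QuotientGroup.mk'_surjective _)
  le_succ i := Subgroup.map_mono (h.le_succ _)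
  zero := by simp
  last := by
    rw [h.last, ← MonoidHom.range_eq_map, MonoidHom.range_eq_top]
    exact QuotientGroup.mk'_surjective _
  cyclic i hi := by
    obtain ⟨y, hy, hgen⟩ := h.cyclic (i + 1) (by omega)
    refine ⟨_, Subgroup.mem_map_of_mem _ hy, ?_⟩
    rintro _ ⟨x, hx, rfl⟩
    obtain ⟨k, hk⟩ := hgen x hx
    exact ⟨k, _, hk, by simp⟩

theorem mem_of_orderOf_dvd_coprime_index {G : Type*} [Group G] {N : Subgroup G} [N.Normal]
    {m : ℕ} {x : G} (hx : orderOf x ∣ m) (hm : Nat.Coprime m N.index) : x ∈ N := by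
  rw [← QuotientGroup.eq_one_iff, ← orderOf_eq_one_iff]
  have h1 : orderOf (x : G ⧸ N) ∣ m := (orderOf_map_dvd (QuotientGroup.mk' N) x).trans hx
  have h2 : orderOf (x : G ⧸ N) ∣ N.index := orderOf_dvd_natCard _
  exact Nat.eq_one_of_dvd_coprimes hm h1 h2

theorem mem_iff_odd_orderOf {G : Type*} [Group G] [Finite G] {N : Subgroup G} [N.Normal]
    (ho : Odd (Nat.card N)) {k : ℕ} (hk : N.index = 2 ^ k) {x : G} :
    x ∈ N ↔ Odd (orderOf x) := by
  constructor
  · intro h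
    exact ho.of_dvd_nat (N.orderOf_dvd_natCard h)
  · intro h
    refine mem_of_orderOf_dvd_coprime_index (dvd_refl _) ?_
    rw [hk]
    exact (Nat.coprime_two_right.mpr h).pow_right k

/-- A finite group whose Sylow 2-subgroups are cyclic has a normal 2-complement. -/
theorem exists_odd_complement_of_cyclic_sylow {M : Type*} [Group M] [Finite M]
    (hcyc : ∀ Q : Sylow 2 M, IsCyclic Q) :
    ∃ K : Subgroup M, K.Normal ∧ Odd (Nat.card K) ∧ ∃ k, K.index = 2 ^ k := by
  have : Fact (Nat.Prime 2) := ⟨Nat.prime_two⟩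
  by_cases h2 : 2 ∣ Nat.card M
  · have hmin : (Nat.card M).minFac = 2 := (Nat.minFac_eq_two_iff _).mpr h2
    obtain ⟨Q⟩ : Nonempty (Sylow 2 M) := inferInstance
    have hc := IsCyclic.isComplement' hmin (hcyc Q)
    refine ⟨(MonoidHom.transferSylow Q (IsCyclic.normalizer_le_centralizer hmin (hcyc Q))).ker,
      inferInstance, ?_, ?_⟩
    · rw [← Nat.not_even_iff_odd, even_iff_two_dvd]
      exact MonoidHom.not_dvd_card_ker_transferSylow Q _
    · obtain ⟨k, hk⟩ := IsPGroup.iff_card.mp Q.isPGroup'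
      exact ⟨k, by rw [hc.symm.index_eq_card, hk]⟩
  · refine ⟨⊤, inferInstance, ?_, 0, by simp⟩
    rw [← Nat.not_even_iff_odd, even_iff_two_dvd, Subgroup.card_top]
    exact h2

theorem IsCyclicSeries.exists_odd_complement (n : ℕ) :
    ∀ {G : Type*} [Group G] [Finite G] {c : ℕ → Subgroup G}, IsCyclicSeries n c →
      ∃ N : Subgroup G, N.Normal ∧ Odd (Nat.card N) ∧ ∃ k, N.index = 2 ^ k := by
  induction n with
  | zero =>
    intro G _ _ c h
    refine ⟨⊥, inferInstance, by simp, 0, ?_⟩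
    rw [← h.zero, h.last]
    simp
  | succ n ih =>
    intro G _ _ c h
    have := h.normal 1
    obtain ⟨N, hN, hNo, k, hNk⟩ := ih h.quotient
    let π := QuotientGroup.mk' (c 1)
    have hπ : Function.Surjective π := QuotientGroup.mk'_surjective _
    let M := N.comap π
    have hMn : M.Normal := hN.comap π
    have hMi : M.index = 2 ^ k := by rw [Subgroup.index_comap_of_surjective _ hπ, hNk]
    have hCM : c 1 ≤ M := by
      intro x hx
      rw [Subgroup.mem_comap, show π x = 1 from (QuotientGroup.eq_one_iff x).mpr hx]
      exact N.one_mem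
    have hrel : Odd (((c 1).subgroupOf M).index) := by
      have h1 : (c 1).relIndex M * M.index = (c 1).index := Subgroup.relIndex_mul_index hCM
      have h2 : (c 1).index = Nat.card N * N.index := by
        rw [Subgroup.card_mul_index]
        rfl
      rw [h2, hMi, hNk] at h1
      have h3 := Nat.eq_of_mul_eq_mul_right (by positivity) h1
      change Odd ((c 1).relIndex M)
      rwa [h3]
    have hCcyc : IsCyclic (c 1) := by
      obtain ⟨y, hy, hgen⟩ := h.cyclic 0 (by omega)
      refine ⟨⟨y, hy⟩, fun ⟨x, hx⟩ => ?_⟩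
      obtain ⟨j, hj⟩ := hgen x hx
      rw [h.zero, Subgroup.mem_bot, inv_mul_eq_one] at hj
      exact ⟨j, Subtype.ext (by simpa using hj)⟩
    have hQ : ∀ Q : Sylow 2 M, IsCyclic Q := by
      intro Q
      have hle : (Q : Subgroup M) ≤ (c 1).subgroupOf M := by
        intro q hq
        obtain ⟨j, hj⟩ := IsPGroup.iff_orderOf.mp Q.isPGroup' ⟨q, hq⟩
        rw [Subgroup.orderOf_mk] at hj
        refine mem_of_orderOf_dvd_coprime_index hj.dvd ?_
        exact (Nat.coprime_two_left.mpr hrel).pow_left j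
      let f : Q →* c 1 := (M.subtype.comp (Q : Subgroup M).subtype).codRestrict (c 1) fun q =>
        hle q.2
      refine isCyclic_of_injective f fun a b hab => ?_
      have := congrArg Subtype.val hab
      exact Subtype.ext (Subtype.ext this)
    obtain ⟨K, hK, hKo, l, hKl⟩ := exists_odd_complement_of_cyclic_sylow hQ
    have hmem : ∀ x : G, x ∈ K.map M.subtype ↔ x ∈ M ∧ Odd (orderOf x) := by
      intro x
      constructor
      · rintro ⟨y, hy, rfl⟩
        refine ⟨y.2, ?_⟩
        rw [Subgroup.coe_subtype, Subgroup.orderOf_coe]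
        exact (mem_iff_odd_orderOf hKo hKl).mp hy
      · rintro ⟨hx, ho⟩
        refine ⟨⟨x, hx⟩, (mem_iff_odd_orderOf hKo hKl).mpr ?_, rfl⟩
        rwa [Subgroup.orderOf_mk]
    have hcard : Nat.card (K.map M.subtype) = Nat.card K :=
      Subgroup.card_map_of_injective M.subtype_injective
    refine ⟨K.map M.subtype, ⟨fun x hx g => ?_⟩, by rwa [hcard], l + k, ?_⟩
    · rw [hmem] at hx ⊢
      refine ⟨hMn.conj_mem x hx.1 g, ?_⟩
      have : orderOf (g * x * g⁻¹) = orderOf x := by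
        simpa using orderOf_injective (MulAut.conj g).toMonoidHom (MulAut.conj g).injective x
      rw [this]
      exact hx.2
    · have e1 := (K.map M.subtype).card_mul_index
      rw [hcard, ← M.card_mul_index, ← K.card_mul_index, hKl, hMi, mul_assoc, ← pow_add] at e1
      exact Nat.eq_of_mul_eq_mul_left hKo.pos e1

theorem IsCyclicSeries.exists_prime_section {G : Type*} [Group G] [Finite G] {n : ℕ}
    {c : ℕ → Subgroup G} (h : IsCyclicSeries n c) (N : Subgroup G) [N.Normal] {w : G}
    (hw : w ∈ N) (hw1 : w ≠ 1) :
    ∃ L : Subgroup G, L.Normal ∧ L ≤ N ∧ w ∉ L ∧ (∃ p, p.Prime ∧ w ^ p ∈ L) ∧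
      ∀ g, ∃ m : ℤ, g * w * g⁻¹ * (w ^ m)⁻¹ ∈ L := by
  classical
  have hex : ∃ i, w ∈ c i := ⟨n, h.last ▸ Subgroup.mem_top w⟩
  obtain ⟨i, hi⟩ : ∃ i, Nat.find hex = i + 1 := by
    refine Nat.exists_eq_succ_of_ne_zero fun h0 => hw1 ?_
    have := Nat.find_spec hex
    rwa [h0, h.zero, Subgroup.mem_bot] at this
  have hwi : w ∈ c (i + 1) := hi ▸ Nat.find_spec hex
  have hwi' : w ∉ c i := Nat.find_min hex (by omega)
  have hin : i < n := by
    have := Nat.find_min' hex (h.last ▸ Subgroup.mem_top w : w ∈ c n)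
    omega
  obtain ⟨y, hy, hgen⟩ := h.cyclic i hin
  have := h.normal i
  have hconj : ∀ g, ∃ m : ℤ, g * w * g⁻¹ * (w ^ m)⁻¹ ∈ c i ⊓ N := by
    intro g
    obtain ⟨k, hk⟩ := hgen w hwi
    obtain ⟨m, hm⟩ := hgen _ ((h.normal (i + 1)).conj_mem y hy g)
    refine ⟨m, ?_, N.mul_mem (‹N.Normal›.conj_mem w hw g) (N.inv_mem (N.zpow_mem hw m))⟩
    have hk' : (w : G ⧸ c i) = (y : G ⧸ c i) ^ k := by
      rw [← QuotientGroup.mk_zpow]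
      exact (QuotientGroup.eq.mpr hk).symm
    have hm' : (g : G ⧸ c i) * y * (g : G ⧸ c i)⁻¹ = (y : G ⧸ c i) ^ m := by
      have := (QuotientGroup.eq.mpr hm).symm
      simpa using this
    change _ ∈ c i
    rw [← QuotientGroup.eq_one_iff]
    rw [QuotientGroup.mk_mul, QuotientGroup.mk_mul, QuotientGroup.mk_mul, QuotientGroup.mk_inv,
      QuotientGroup.mk_inv, QuotientGroup.mk_zpow, hk', ← conj_zpow, hm', ← zpow_mul,
      ← zpow_mul, mul_comm, mul_inv_cancel]
  have hL0 : (c i ⊓ N).Normal := inferInstance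
  let q := QuotientGroup.mk' (c i ⊓ N)
  have hqw : q w ≠ 1 := fun e => hwi' ((QuotientGroup.eq_one_iff w).mp e).1
  obtain ⟨p, hp, s, hs⟩ := Nat.exists_prime_and_dvd (n := orderOf (q w))
    (by rwa [Ne, orderOf_eq_one_iff])
  have hDn : (Subgroup.zpowers (q w ^ p)).Normal := by
    refine ⟨fun x hx g => ?_⟩
    obtain ⟨j, rfl⟩ := hx
    obtain ⟨g, rfl⟩ := QuotientGroup.mk'_surjective _ g
    obtain ⟨m, hm⟩ := hconj g
    have e : q g * q w * (q g)⁻¹ = q w ^ m := by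
      have : q (g * w * g⁻¹ * (w ^ m)⁻¹) = 1 := (QuotientGroup.eq_one_iff _).mpr hm
      rw [map_mul, map_inv, mul_inv_eq_one] at this
      simpa using this
    refine ⟨m * j, ?_⟩
    change (q w ^ p) ^ (m * j) = q g * (q w ^ p) ^ j * (q g)⁻¹
    rw [← conj_zpow, ← conj_pow, e, zpow_mul]
    congr 1
    rw [← zpow_natCast, ← zpow_natCast, zpow_comm]
  refine ⟨(Subgroup.zpowers (q w ^ p)).comap q, hDn.comap q, ?_, ?_, ⟨p, hp, ?_⟩, fun g => ?_⟩
  · rintro x ⟨j, hj⟩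
    have hj' : q ((w ^ p) ^ j) = q x := by simpa using hj
    have := (QuotientGroup.eq.mp hj').2
    have := N.mul_mem (N.zpow_mem (N.pow_mem hw p) j) this
    rwa [mul_inv_cancel_left] at this
  · rintro ⟨j, hj⟩
    have hj' : q w ^ ((p : ℤ) * j - 1) = 1 := by
      rw [zpow_sub, zpow_mul, zpow_natCast, zpow_one, mul_inv_eq_one]
      exact hj
    rw [← orderOf_dvd_iff_zpow_eq_one, hs] at hj'
    have h1 : (p : ℤ) ∣ (p : ℤ) * j - 1 := (Dvd.intro _ (by push_cast; rfl)).trans hj'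
    have h2 : (p : ℤ) ∣ 1 := by
      have := (dvd_mul_right (p : ℤ) j).sub h1
      simpa using this
    have := Int.isUnit_iff_natAbs_eq.mp (isUnit_of_dvd_one h2)
    exact hp.one_lt.ne' (by simpa using this)
  · rw [Subgroup.mem_comap, map_pow]
    exact Subgroup.mem_zpowers _
  · obtain ⟨m, hm⟩ := hconj g
    refine ⟨m, ?_⟩
    rw [Subgroup.mem_comap, show q _ = 1 from (QuotientGroup.eq_one_iff _).mpr hm]
    exact Subgroup.one_mem _

end Supersolvable

section Twist

variable {K : Type*} [Group K] {w : K}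

theorem Commute.of_conj_eq {g : K} (h : g * w * g⁻¹ = w) : Commute g w :=
  mul_inv_eq_iff_eq_mul.mp h

theorem conj_mul_eq_zpow {g h : K} {s t : ℤˣ} (hg : g * w * g⁻¹ = w ^ (s : ℤ))
    (hh : h * w * h⁻¹ = w ^ (t : ℤ)) :
    g * h * w * (g * h)⁻¹ = w ^ ((s * t : ℤˣ) : ℤ) := by
  calc g * h * w * (g * h)⁻¹ = g * (h * w * h⁻¹) * g⁻¹ := by group
    _ = (g * w * g⁻¹) ^ (t : ℤ) := by rw [hh, conj_zpow]
    _ = _ := by rw [hg, ← zpow_mul, Units.val_mul]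

theorem conj_inv_eq_zpow {g : K} {s : ℤˣ} (hg : g * w * g⁻¹ = w ^ (s : ℤ)) :
    g⁻¹ * w * g⁻¹⁻¹ = w ^ ((s⁻¹ : ℤˣ) : ℤ) := by
  have h : w = (g⁻¹ * w * g⁻¹⁻¹) ^ (s : ℤ) := by
    rw [conj_zpow, ← hg]
    group
  rcases Int.units_eq_one_or s with rfl | rfl
  · simpa using h.symm
  · simp only [Units.val_neg, Units.val_one, zpow_neg, zpow_one] at h
    rw [inv_neg, inv_one, Units.val_neg, Units.val_one, zpow_neg, zpow_one]
    exact (inv_eq_iff_eq_inv.mp h.symm)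

theorem conj_pow_eq_zpow {g : K} {s : ℤˣ} (hg : g * w * g⁻¹ = w ^ (s : ℤ)) (n : ℕ) :
    g ^ n * w * (g ^ n)⁻¹ = w ^ ((s ^ n : ℤˣ) : ℤ) := by
  induction n with
  | zero => simp
  | succ n ih => rw [pow_succ, pow_succ]; exact conj_mul_eq_zpow ih hg

theorem conj_zpow_eq_zpow {g : K} {s : ℤˣ} (hg : g * w * g⁻¹ = w ^ (s : ℤ)) (n : ℤ) :
    g ^ n * w * (g ^ n)⁻¹ = w ^ ((s ^ n : ℤˣ) : ℤ) := by
  obtain ⟨m, rfl | rfl⟩ := n.eq_nat_or_neg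
  · simpa using conj_pow_eq_zpow hg m
  · simpa using conj_inv_eq_zpow (conj_pow_eq_zpow hg m)

/-- An element of odd order cannot invert `w` unless `w` is an involution. -/
theorem eq_one_of_odd_of_conj_eq_zpow {g : K} {s : ℤˣ} (hg : g * w * g⁻¹ = w ^ (s : ℤ))
    (ho : Odd (orderOf g)) (hw : w * w ≠ 1) : s = 1 := by
  refine (Int.units_eq_one_or s).resolve_right ?_
  rintro rfl
  have h := conj_pow_eq_zpow hg (orderOf g)
  rw [ho.neg_one_pow, pow_orderOf_eq_one] at h
  simp only [one_mul, inv_one, mul_one, Units.val_neg, Units.val_one, zpow_neg, zpow_one] at h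
  exact hw (mul_self_of_eq_inv h)

theorem exists_conj_eq_zpow_of_involution {p : ℕ} (hp : p.Prime) (hwp : orderOf w = p) {t : K}
    (ht : t * t = 1) {m : ℤ} (hm : t * w * t⁻¹ = w ^ m) :
    ∃ s : ℤˣ, t * w * t⁻¹ = w ^ (s : ℤ) := by
  have h1 : w ^ (m * m - 1) = 1 := by
    rw [zpow_sub, zpow_mul, zpow_one, mul_inv_eq_one]
    calc (w ^ m) ^ m = (t * w * t⁻¹) ^ m := by rw [hm]
      _ = t * (t * w * t⁻¹) * t⁻¹ := by rw [conj_zpow, hm]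
      _ = (t * t) * w * (t * t)⁻¹ := by group
      _ = w := by rw [ht]; simp
  rw [← orderOf_dvd_iff_zpow_eq_one, hwp, show m * m - 1 = (m - 1) * (m + 1) by ring] at h1
  rcases (Nat.prime_iff_prime_int.mp hp).dvd_or_dvd h1 with h | h
  · refine ⟨1, ?_⟩
    rw [← hwp, orderOf_dvd_iff_zpow_eq_one, zpow_sub, zpow_one, mul_inv_eq_one] at h
    simpa [hm] using h
  · refine ⟨-1, ?_⟩
    rw [← hwp, orderOf_dvd_iff_zpow_eq_one, zpow_add, zpow_one, mul_eq_one_iff_eq_inv] at h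
    simpa [hm] using h

/-- If `z` agrees with `(a * b) ^ j` up to an element of odd order, then the signs by which the
involutions `a`, `b`, `z` act on `⟨w⟩` satisfy the corresponding relation. -/
theorem sign_eq_of_eq_mul {a b z n : K} {s t u : ℤˣ} (ha : a * w * a⁻¹ = w ^ (s : ℤ))
    (hb : b * w * b⁻¹ = w ^ (t : ℤ)) (hz : z * w * z⁻¹ = w ^ (u : ℤ)) {j : ℤ}
    (hn : z = (a * b) ^ j * n) (ho : Odd (orderOf n)) (hw : w * w ≠ 1) : u = (s * t) ^ j := by
  have h1 := conj_inv_eq_zpow (conj_zpow_eq_zpow (conj_mul_eq_zpow ha hb) j)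
  have h2 := conj_mul_eq_zpow h1 hz
  rw [hn, inv_mul_cancel_left] at h2
  exact (inv_mul_eq_one.mp (eq_one_of_odd_of_conj_eq_zpow h2 ho hw)).symm

end Twist

section Quotient

theorem not_isCyclic_quotient {G : Type*} [Group G] {N : Subgroup G} [N.Normal]
    (hN : Odd (Nat.card N)) (hsyl : ∀ Q : Sylow 2 G, ¬ IsCyclic ↥(Q : Subgroup G)) :
    ¬ IsCyclic (G ⧸ N) := by
  have : Fact (Nat.Prime 2) := ⟨Nat.prime_two⟩
  intro hc
  obtain ⟨Q⟩ : Nonempty (Sylow 2 G) := inferInstance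
  refine hsyl Q (isCyclic_of_injective ((QuotientGroup.mk' N).comp (Q : Subgroup G).subtype) ?_)
  rw [injective_iff_map_eq_one]
  rintro ⟨q, hq⟩ h
  have hqN : q ∈ N := (QuotientGroup.eq_one_iff q).mp h
  obtain ⟨j, hj⟩ := IsPGroup.iff_orderOf.mp Q.isPGroup' ⟨q, hq⟩
  rw [Subgroup.orderOf_mk] at hj
  have h1 : orderOf q ∣ Nat.card N := N.orderOf_dvd_natCard hqN
  have h2 : Nat.Coprime (2 ^ j) (Nat.card N) := (Nat.coprime_two_left.mpr hN).pow_left j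
  have := Nat.eq_one_of_dvd_coprimes h2 hj.dvd h1
  exact Subtype.ext (orderOf_eq_one_iff.mp this)

theorem exists_dual_signs {P G : Type*} [Group P] [Group G] (π : G →* P)
    (hπ : Function.Surjective π) {X : Set G} (hX : Subgroup.closure X = ⊤) {χ₁ χ₂ : P →* ℤˣ}
    (h1 : χ₁ ≠ 1) (h2 : χ₂ ≠ 1) (h12 : χ₁ ≠ χ₂) :
    ∃ x ∈ X, ∃ y ∈ X, ∃ α β : P →* ℤˣ, α (π x) = -1 ∧ α (π y) = 1 ∧ β (π x) = 1 ∧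
      β (π y) = -1 := by
  have key : ∀ χ : P →* ℤˣ, χ ≠ 1 → ∃ x ∈ X, χ (π x) = -1 := by
    intro χ hχ
    by_contra! h
    refine hχ ((MonoidHom.cancel_right hπ).mp ?_)
    refine MonoidHom.eq_of_eqOn_dense hX fun x hx => ?_
    exact (Int.units_eq_one_or _).resolve_right (h x hx)
  have key2 : ∀ x ∈ X, ∀ α β : P →* ℤˣ, α (π x) = -1 → β (π x) = 1 → β ≠ 1 →
      ∃ y ∈ X, ∃ α β : P →* ℤˣ, α (π x) = -1 ∧ α (π y) = 1 ∧ β (π x) = 1 ∧ β (π y) = -1 := by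
    intro x hx α β hα hβ hβ1
    obtain ⟨y, hy, hyβ⟩ := key β hβ1
    rcases Int.units_eq_one_or (α (π y)) with h | h
    · exact ⟨y, hy, α, β, hα, h, hβ, hyβ⟩
    · exact ⟨y, hy, α * β, β, by simp [hα, hβ], by simp [h, hyβ], hβ, hyβ⟩
  obtain ⟨x, hx, hx1⟩ := key χ₁ h1
  refine ⟨x, hx, ?_⟩
  rcases Int.units_eq_one_or (χ₂ (π x)) with h | h
  · exact key2 x hx χ₁ χ₂ hx1 h h2
  · refine key2 x hx χ₁ (χ₁ * χ₂) hx1 (by simp [hx1, h]) fun e => h12 ?_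
    ext1 g
    have := congrArg (fun f : P →* ℤˣ => f g) e
    simp only [MonoidHom.mul_apply, MonoidHom.one_apply] at this
    rw [mul_eq_one_iff_eq_inv.mp this, Int.units_inv_eq_self]

end Quotient

section OddValency

variable {G P : Type*} [Group G] [Group P]

/-- A connection set `X` of odd size, with a homomorphism onto a 2-group killing no involution. -/
structure IsOddConnectionSet (π : G →* P) (X : Finset G) : Prop where
  isPGroup : IsPGroup 2 P
  map_ne_one : ∀ t, t * t = 1 → t ≠ 1 → π t ≠ 1
  one_notMem : 1 ∉ X
  inv_mem : ∀ x ∈ X, x⁻¹ ∈ X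
  odd_card : Odd X.card

theorem map_mul_self (π : G →* P) {t : G} (ht : t * t = 1) : π t * π t = 1 := by
  rw [← map_mul, ht, map_one]

theorem eq_of_mem_zpowers_of_mul_self {c s t : P} [Finite P] (hs : s ∈ Subgroup.zpowers c)
    (ht : t ∈ Subgroup.zpowers c) (hs2 : s * s = 1) (ht2 : t * t = 1) (hs1 : s ≠ 1)
    (ht1 : t ≠ 1) : s = t := by
  classical
  have : Fintype (Subgroup.zpowers c) := Fintype.ofFinite _
  by_contra hst
  have h := IsCyclic.card_pow_eq_one_le (α := Subgroup.zpowers c) (n := 2) (by norm_num)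
  have hsub : ({1, ⟨s, hs⟩, ⟨t, ht⟩} : Finset (Subgroup.zpowers c)) ⊆
      Finset.univ.filter fun a => a ^ 2 = 1 := by
    intro x hx
    simp only [Finset.mem_insert, Finset.mem_singleton] at hx
    rw [Finset.mem_filter]
    refine ⟨Finset.mem_univ _, ?_⟩
    rcases hx with rfl | rfl | rfl
    · simp
    · exact Subtype.ext (by simp [pow_two, hs2])
    · exact Subtype.ext (by simp [pow_two, ht2])
  have h3 := (Finset.card_le_card hsub).trans h
  rw [Finset.card_eq_three.mpr ⟨1, ⟨s, hs⟩, ⟨t, ht⟩, fun e => hs1 (congrArg Subtype.val e).symm,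
    fun e => ht1 (congrArg Subtype.val e).symm, fun e => hst (congrArg Subtype.val e), rfl⟩] at h3
  omega

theorem notMem_zpowers_of_sign (χ : P →* ℤˣ) {a t : P} (ha : a * a = 1) (hχa : χ a = -1)
    (hχt : χ t = 1) (ht : t ≠ 1) : t ∉ Subgroup.zpowers a := by
  rintro ⟨i, rfl⟩
  have ha2 : a ^ (2 : ℤ) = 1 := by rw [zpow_two, ha]
  rcases Int.even_or_odd' i with ⟨k, rfl | rfl⟩
  · exact ht (by simp only [zpow_mul, ha2, one_zpow])
  · simp only [zpow_add, zpow_mul, ha2, one_zpow, one_mul, zpow_one] at hχt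
    rw [hχa] at hχt
    exact absurd hχt (by decide)

theorem eq_zpow_of_mem_closure {a b t : P} (ha : a * a = 1) (hb : b * b = 1) {α β : P →* ℤˣ}
    (haα : α a = -1) (hbα : α b = 1) (haβ : β a = 1) (hbβ : β b = -1) (ht : α t = β t)
    (hmem : t ∈ Subgroup.closure {a, b}) : ∃ j : ℤ, t = (a * b) ^ j := by
  obtain ⟨j, h | h⟩ := dihedral_form ha hb hmem
  · exact ⟨j, h⟩
  · exfalso
    rw [h] at ht
    simp only [map_mul, map_zpow, haα, hbα, haβ, hbβ, mul_one, one_mul] at ht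
    rcases Int.units_eq_one_or ((-1 : ℤˣ) ^ j) with e | e <;> rw [e] at ht <;>
      exact absurd ht (by decide)

variable [Finite P] [DecidableEq G] {π : G →* P} {X : Finset G}

theorem IsOddConnectionSet.three_involutions (h : IsOddConnectionSet π X) {r s t : G}
    (hrX : r ∈ X) (hsX : s ∈ X) (htX : t ∈ X) (hr : r * r = 1) (hs : s * s = 1) (ht : t * t = 1)
    (hrs : r ≠ s) (hrt : r ≠ t) (hst : s ≠ t) (ε : G → ℤˣ) (er : ∀ g, ε (g * r) = -ε g)
    (es : ∀ g, ε (g * s) = -ε g) (et : ∀ g, ε (g * t) = -ε g) : HasNet X 0 := by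
  refine (hasNet_three_involutions hr hs ht hrs hrt hst ε er es et).extend h.isPGroup π
    h.map_ne_one ?_ h.one_notMem h.inv_mem ?_ h.odd_card
  · simp [Finset.insert_subset_iff, hrX, hsX, htX]
  · rw [Finset.card_eq_three.mpr ⟨r, s, t, hrs, hrt, hst, rfl⟩]
    decide

theorem IsOddConnectionSet.involution_pair (h : IsOddConnectionSet π X) {t x : G}
    (htX : t ∈ X) (hxX : x ∈ X) (ht : t * t = 1) (hx : x * x ≠ 1) (ε : G → ℤˣ)
    (et : ∀ g, ε (g * t) = -ε g) (ex : ∀ g, ε (g * x) = -ε g) : HasNet X 0 := by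
  have hti : t⁻¹ = t := inv_eq_of_mul_eq_one_left ht
  have htx : t ≠ x := fun e => hx (e ▸ ht)
  have htx' : t ≠ x⁻¹ := fun e => htx (by rw [← hti, e, inv_inv])
  refine (hasNet_involution_pair ht (ne_inv_of_mul_self_ne hx) ε et ex).extend h.isPGroup π
    h.map_ne_one ?_ h.one_notMem h.inv_mem ?_ h.odd_card
  · simp [Finset.insert_subset_iff, htX, hxX, h.inv_mem x hxX]
  · rw [Finset.card_eq_three.mpr ⟨t, x, x⁻¹, htx, htx', ne_inv_of_mul_self_ne hx, rfl⟩]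
    decide

/-- Two pairs of non-involutions separated by sign homomorphisms. -/
theorem IsOddConnectionSet.hasNet_of_noninvolutions (h : IsOddConnectionSet π X) {x y : G}
    (hxX : x ∈ X) (hyX : y ∈ X) (hx : x * x ≠ 1) (hy : y * y ≠ 1) {α β : P →* ℤˣ}
    (hxα : α (π x) = -1) (hyα : α (π y) = 1) (hxβ : β (π x) = 1) (hyβ : β (π y) = -1) :
    HasNet X 0 := by
  by_contra hno
  have hpair : ∀ t ∈ X, t * t = 1 → ∀ w ∈ X, w * w ≠ 1 → ∀ χ : P →* ℤˣ, χ (π w) = -1 →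
      χ (π t) = 1 := by
    intro t htX ht w hwX hw χ hχ
    refine (Int.units_eq_one_or _).resolve_right fun hχt => hno ?_
    exact h.involution_pair htX hwX ht hw (fun g => χ (π g)) (by simp [hχt]) (by simp [hχ])
  obtain ⟨z, hzX, hz⟩ := exists_involution_of_odd_card h.inv_mem h.odd_card
  have hzα := hpair z hzX hz x hxX hx α hxα
  have hzβ := hpair z hzX hz y hyX hy β hyβ
  have hz1 : π z ≠ 1 := h.map_ne_one z hz fun e => h.one_notMem (e ▸ hzX)
  have key : ∀ w ∈ X, w * w ≠ 1 → ∀ χ : P →* ℤˣ, χ (π w) = -1 → χ (π z) = 1 →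
      π z ∈ Subgroup.zpowers (π w) := by
    intro w hwX hw χ hχw hχz
    by_contra hmem
    obtain ⟨ε, e1, e2⟩ := exists_sign_pullback h.isPGroup π hmem
    refine hno (h.involution_pair hzX hwX hz hw (fun g => χ (π g) * ε g) (fun g => ?_)
      fun g => ?_)
    · simp [hχz, e2]
    · simp [hχw, e1 g w (Subgroup.mem_zpowers _)]
  have hzx := key x hxX hx α hxα hzα
  have hzy := key y hyX hy β hyβ hzβ
  have hneg : (-1 : ℤˣ) ≠ 1 := by decide
  have yx : y ≠ x := by
    rintro rfl
    exact hneg (hxα.symm.trans hyα)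
  have yx' : y ≠ x⁻¹ := by
    rintro rfl
    simp [hxα, hneg] at hyα
  have zne : ∀ w : G, w * w ≠ 1 → z ≠ w ∧ z ≠ w⁻¹ := by
    intro w hw
    have hzi : z⁻¹ = z := inv_eq_of_mul_eq_one_left hz
    have h1 : z ≠ w := fun e => hw (e ▸ hz)
    exact ⟨h1, fun e => h1 (by rw [← hzi, e, inv_inv])⟩
  refine hno ((hasNet_two_pairs_involution π hx hy hz hz1 hzx hzy α β hxα hyα hxβ hyβ).extend
    h.isPGroup π h.map_ne_one ?_ h.one_notMem h.inv_mem ?_ h.odd_card)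
  · simp [Finset.insert_subset_iff, hxX, hyX, hzX, h.inv_mem x hxX,
      h.inv_mem y hyX]
  · rw [Finset.card_union_of_disjoint, Finset.card_union_of_disjoint,
      Finset.card_pair (ne_inv_of_mul_self_ne hx), Finset.card_pair (ne_inv_of_mul_self_ne hy),
      Finset.card_singleton]
    · decide
    · simp [yx, yx', inv_eq_iff_eq_inv]
    · simp [(zne x hx).1, (zne x hx).2, (zne y hy).1, (zne y hy).2]

/-- An involution on which `α` and `β` agree lies, modulo `ker π`, in the dihedral group generated
by two involutions separated by `α` and `β`, unless there is a flow. -/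
theorem IsOddConnectionSet.exists_eq_zpow (h : IsOddConnectionSet π X) (hno : ¬ HasNet X 0)
    {a b : G} (haX : a ∈ X) (hbX : b ∈ X) (ha : a * a = 1) (hb : b * b = 1) {α β : P →* ℤˣ}
    (haα : α (π a) = -1) (hbα : α (π b) = 1) (haβ : β (π a) = 1) (hbβ : β (π b) = -1)
    {t : G} (htX : t ∈ X) (ht : t * t = 1) (hta : t ≠ a) (htb : t ≠ b) :
    α (π t) = β (π t) ∧ ∃ j : ℤ, π t = (π a * π b) ^ j := by
  have hab : a ≠ b := by
    rintro rfl
    rw [haα] at hbα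
    exact absurd hbα (by decide)
  have heq : α (π t) = β (π t) := by
    by_contra hne
    have hχ : α (π t) * β (π t) = -1 := by
      refine (Int.units_eq_one_or _).resolve_left fun e => hne ?_
      rw [mul_eq_one_iff_eq_inv.mp e, Int.units_inv_eq_self]
    refine hno (h.three_involutions haX hbX htX ha hb ht hab hta.symm htb.symm
      (fun g => α (π g) * β (π g)) (fun g => ?_) (fun g => ?_) fun g => ?_)
    · simp [haα, haβ]
    · simp [hbα, hbβ]
    · simp only [map_mul]
      rw [mul_mul_mul_comm, hχ, mul_neg_one]
  refine ⟨heq, ?_⟩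
  by_cases hmem : π t ∈ Subgroup.closure {π a, π b}
  · exact eq_zpow_of_mem_closure (map_mul_self π ha) (map_mul_self π hb) haα hbα haβ hbβ heq hmem
  · exfalso
    obtain ⟨ε, e1, e2⟩ := exists_sign_pullback h.isPGroup π hmem
    refine hno (h.three_involutions haX hbX htX ha hb ht hab hta.symm htb.symm
      (fun g => α (π g) * β (π g) * ε g) (fun g => ?_) (fun g => ?_) fun g => ?_)
    · simp [haα, haβ, e1 g a (Subgroup.subset_closure (by simp))]
    · simp [hbα, hbβ, e1 g b (Subgroup.subset_closure (by simp))]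
    · simp only [map_mul, e2, heq]
      rw [mul_mul_mul_comm, Int.units_mul_self, mul_one, mul_neg]

theorem IsOddConnectionSet.hasNet_of_forall_involution (h : IsOddConnectionSet π X)
    (hcard : 5 ≤ X.card) (hinv : ∀ x ∈ X, x * x = 1)
    {a b : G} (haX : a ∈ X) (hbX : b ∈ X) {α β : P →* ℤˣ}
    (haα : α (π a) = -1) (hbα : α (π b) = 1) (haβ : β (π a) = 1) (hbβ : β (π b) = -1) :
    HasNet X 0 := by
  by_contra hno
  have ha := hinv a haX
  have hb := hinv b hbX
  let Y := (X.erase a).erase b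
  have hY : ∀ t ∈ Y, t ∈ X ∧ t ≠ a ∧ t ≠ b := by
    intro t ht
    simp only [Y, Finset.mem_erase] at ht
    exact ⟨ht.2.2, ht.2.1, ht.1⟩
  have hYc : 3 ≤ Y.card := by
    have h1 := Finset.pred_card_le_card_erase (s := X) (a := a)
    have h2 := Finset.pred_card_le_card_erase (s := X.erase a) (a := b)
    simp only [Y]
    omega
  have hneg : (Y.filter fun t => ¬ α (π t) = 1).card ≤ 1 := by
    by_contra! hlt
    obtain ⟨s, hs, t, ht, hst⟩ := Finset.one_lt_card.mp hlt
    rw [Finset.mem_filter] at hs ht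
    obtain ⟨hsX, hsa, -⟩ := hY s hs.1
    obtain ⟨htX, hta, -⟩ := hY t ht.1
    have hs' := (Int.units_eq_one_or _).resolve_left hs.2
    have ht' := (Int.units_eq_one_or _).resolve_left ht.2
    exact hno (h.three_involutions haX hsX htX ha (hinv s hsX) (hinv t htX) hsa.symm hta.symm hst
      (fun g => α (π g)) (by simp [haα]) (by simp [hs']) (by simp [ht']))
  have hpos : 1 < (Y.filter fun t => α (π t) = 1).card := by
    have := Finset.card_filter_add_card_filter_not (s := Y) fun t => α (π t) = 1
    omega
  obtain ⟨s, hs, t, ht, hst⟩ := Finset.one_lt_card.mp hpos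
  rw [Finset.mem_filter] at hs ht
  obtain ⟨hsX, hsa, hsb⟩ := hY s hs.1
  obtain ⟨htX, hta, htb⟩ := hY t ht.1
  obtain ⟨-, i, hi⟩ := h.exists_eq_zpow hno haX hbX ha hb haα hbα haβ hbβ hsX (hinv s hsX) hsa hsb
  obtain ⟨-, j, hj⟩ := h.exists_eq_zpow hno haX hbX ha hb haα hbα haβ hbβ htX (hinv t htX) hta htb
  have hs1 : π s ≠ 1 := h.map_ne_one s (hinv s hsX) fun e => h.one_notMem (e ▸ hsX)
  have ht1 : π t ≠ 1 := h.map_ne_one t (hinv t htX) fun e => h.one_notMem (e ▸ htX)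
  have heq : π s = π t := eq_of_mem_zpowers_of_mul_self (c := π a * π b) ⟨i, hi.symm⟩ ⟨j, hj.symm⟩
    (map_mul_self π (hinv s hsX)) (map_mul_self π (hinv t htX)) hs1 ht1
  obtain ⟨ε, e1, e2⟩ := exists_sign_pullback h.isPGroup π
    (notMem_zpowers_of_sign α (map_mul_self π ha) haα hs.2 hs1)
  have et : ∀ g, ε (g * t) = -ε g := by
    intro g
    rw [← e2, ← e1 (g * s) (s⁻¹ * t) (by simp [heq]), mul_assoc,
      mul_inv_cancel_left]
  refine hno (h.three_involutions haX hsX htX ha (hinv s hsX) (hinv t htX) hsa.symm hta.symm hst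
    (fun g => α (π g) * ε g) (fun g => ?_) (fun g => ?_) fun g => ?_)
  · simp [haα, e1 g a (Subgroup.mem_zpowers _)]
  · simp [hs.2, e2]
  · simp [ht.2, et]

end OddValency

section MixedConnectionSet

variable {G P K : Type*} [Group G] [Group P] [Group K] [Finite P] [Finite K] [DecidableEq G]
  {π : G →* P} {X : Finset G}

theorem IsOddConnectionSet.hasNet_of_commute (h : IsOddConnectionSet π X) (ρ : G →* K)
    (σ : K →* P) (hσ : ∀ g, σ (ρ g) = π g) {a b z w : G} (haX : a ∈ X) (hbX : b ∈ X)
    (hzX : z ∈ X) (hwX : w ∈ X) (ha : a * a = 1) (hb : b * b = 1) (hz : z * z = 1)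
    (hab : a ≠ b) (haz : a ≠ z) (hbz : b ≠ z) (hw : w * w ≠ 1) (hπw : π w = 1)
    (hzw : Commute (ρ z) (ρ w)) (ho : Odd (orderOf (ρ w))) (hw1 : ρ w ≠ 1)
    (hn : (Subgroup.zpowers (ρ w)).Normal) (f χ : P → ℤˣ) (fa : ∀ g, f (g * π a) = -f g)
    (fz : ∀ g, f (g * π z) = -f g) (χb : ∀ g, χ (g * π b) = -χ g)
    (χz : ∀ g, χ (g * π z) = -χ g) : HasNet X 0 := by
  have hne : ∀ t : G, t * t = 1 → t ≠ w ∧ t ≠ w⁻¹ := by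
    intro t ht
    have hti : t⁻¹ = t := inv_eq_of_mul_eq_one_left ht
    have h1 : t ≠ w := fun e => hw (e ▸ ht)
    exact ⟨h1, fun e => h1 (by rw [← hti, e, inv_inv])⟩
  refine (hasNet_three_involutions_pair ρ ha hb hz hab haz hbz hw hzw ho hw1 hn
    (fun g => f (σ g)) (fun g => χ (σ g)) ?_ ?_ ?_ ?_ ?_ ?_).extend h.isPGroup π h.map_ne_one ?_
    h.one_notMem h.inv_mem ?_ h.odd_card
  · simp [hσ, fa]
  · simp [hσ, fz]
  · simp [hσ, hπw]
  · simp [hσ, χb]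
  · simp [hσ, χz]
  · simp [hσ, hπw]
  · simp [Finset.insert_subset_iff, haX, hbX, hzX, hwX, h.inv_mem w hwX]
  · rw [Finset.card_union_of_disjoint, Finset.card_union_of_disjoint,
      Finset.card_union_of_disjoint, Finset.card_pair (ne_inv_of_mul_self_ne hw)]
    · simp only [Finset.card_singleton]
      decide
    · simpa using hab
    · simp [(hne a ha).1.symm, (hne a ha).2.symm, (hne b hb).1.symm, (hne b hb).2.symm]
    · simp [haz.symm, hbz.symm, (hne z hz).1, (hne z hz).2]

/-- Two involutions separated by sign homomorphisms together with a non-involution. -/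
theorem IsOddConnectionSet.hasNet_of_mixed [Finite G] {n k : ℕ} {c : ℕ → Subgroup G}
    (hc : IsCyclicSeries n c) {N : Subgroup G} [N.Normal] (hN : Odd (Nat.card N))
    (hk : N.index = 2 ^ k) (h : IsOddConnectionSet (QuotientGroup.mk' N) X) {a b w : G}
    (haX : a ∈ X) (hbX : b ∈ X) (hwX : w ∈ X) (ha : a * a = 1) (hb : b * b = 1)
    (hw : w * w ≠ 1) {α β : G ⧸ N →* ℤˣ} (haα : α (QuotientGroup.mk' N a) = -1)
    (hbα : α (QuotientGroup.mk' N b) = 1) (haβ : β (QuotientGroup.mk' N a) = 1)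
    (hbβ : β (QuotientGroup.mk' N b) = -1) : HasNet X 0 := by
  by_contra hno
  set π := QuotientGroup.mk' N with hπ
  have hneg : (-1 : ℤˣ) ≠ 1 := by decide
  have hab : a ≠ b := by
    rintro rfl
    exact hneg (haα.symm.trans hbα)
  have hwα : α (π w) = 1 := (Int.units_eq_one_or _).resolve_right fun e =>
    hno (h.involution_pair haX hwX ha hw (fun g => α (π g)) (by simp [haα]) (by simp [e]))
  have hwmem : π w ∈ Subgroup.zpowers (π a) := by
    by_contra hmem
    obtain ⟨ε, e1, e2⟩ := exists_sign_pullback h.isPGroup π hmem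
    refine hno (h.involution_pair haX hwX ha hw (fun g => α (π g) * ε g) (fun g => ?_)
      fun g => ?_)
    · simp [haα, e1 g a (Subgroup.mem_zpowers _)]
    · simp [hwα, e2]
  have hπw : π w = 1 := by
    by_contra hne
    exact notMem_zpowers_of_sign α (map_mul_self π ha) haα hwα hne hwmem
  have hwN : w ∈ N := (QuotientGroup.eq_one_iff w).mp hπw
  have hwo : Odd (orderOf w) := (mem_iff_odd_orderOf hN hk).mp hwN
  have hw1 : w ≠ 1 := by
    rintro rfl
    exact hw (mul_one 1)
  obtain ⟨z, hzX, hz, hza, hzb⟩ : ∃ z ∈ X, z * z = 1 ∧ z ≠ a ∧ z ≠ b := by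
    have hai : a⁻¹ = a := inv_eq_of_mul_eq_one_left ha
    have hbi : b⁻¹ = b := inv_eq_of_mul_eq_one_left hb
    have hsub : {a, b} ⊆ X := by simp [Finset.insert_subset_iff, haX, hbX]
    obtain ⟨z, hz, hzz⟩ := exists_involution_of_odd_card (Y := X \ {a, b})
      (sdiff_inv_closed (by simp [hai, hbi]) h.inv_mem) (by
        rw [Finset.card_sdiff_of_subset hsub, Finset.card_pair hab]
        exact Nat.Odd.sub_even
          (by simpa [Finset.card_pair hab] using Finset.card_le_card hsub) h.odd_card (by decide))
    simp only [Finset.mem_sdiff, Finset.mem_insert, Finset.mem_singleton, not_or] at hz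
    exact ⟨z, hz.1, hzz, hz.2.1, hz.2.2⟩
  have hz1 : π z ≠ 1 := h.map_ne_one z hz fun e => h.one_notMem (e ▸ hzX)
  obtain ⟨hzαβ, j, hj⟩ := h.exists_eq_zpow hno haX hbX ha hb haα hbα haβ hbβ hzX hz hza hzb
  obtain ⟨L, hLn, hLN, hwL, ⟨p, hp, hwp⟩, hconj⟩ := hc.exists_prime_section N hwN hw1
  let ρ := QuotientGroup.mk' L
  let σ : G ⧸ L →* G ⧸ N := QuotientGroup.map L N (MonoidHom.id G) hLN
  have hσ : ∀ g, σ (ρ g) = π g := fun g => rfl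
  have hρw1 : ρ w ≠ 1 := fun e => hwL ((QuotientGroup.eq_one_iff w).mp e)
  have hρwp : orderOf (ρ w) = p := by
    have : Fact p.Prime := ⟨hp⟩
    exact orderOf_eq_prime ((map_pow ρ w p).symm.trans ((QuotientGroup.eq_one_iff _).mpr hwp)) hρw1
  have hρwo : Odd (orderOf (ρ w)) := hwo.of_dvd_nat (orderOf_map_dvd ρ w)
  have hρww : ρ w * ρ w ≠ 1 := fun e => hρw1 (eq_one_of_mul_self_of_odd_orderOf e hρwo)
  have hρconj : ∀ g, ∃ m : ℤ, ρ g * ρ w * (ρ g)⁻¹ = ρ w ^ m := by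
    intro g
    obtain ⟨m, hm⟩ := hconj g
    have e : ρ (g * w * g⁻¹ * (w ^ m)⁻¹) = 1 := (QuotientGroup.eq_one_iff _).mpr hm
    refine ⟨m, mul_inv_eq_one.mp ?_⟩
    simpa only [map_mul, map_inv, map_zpow] using e
  have hρn : (Subgroup.zpowers (ρ w)).Normal := by
    refine ⟨?_⟩
    rintro _ ⟨i, rfl⟩ q
    obtain ⟨g, rfl⟩ := QuotientGroup.mk'_surjective L q
    obtain ⟨m, hm⟩ := hρconj g
    refine ⟨m * i, ?_⟩
    change ρ w ^ (m * i) = ρ g * ρ w ^ i * (ρ g)⁻¹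
    rw [zpow_mul, ← hm, conj_zpow]
  have hsign : ∀ t, t * t = 1 → ∃ s : ℤˣ, ρ t * ρ w * (ρ t)⁻¹ = ρ w ^ (s : ℤ) := by
    intro t ht
    obtain ⟨m, hm⟩ := hρconj t
    exact exists_conj_eq_zpow_of_involution hp hρwp (map_mul_self ρ ht) hm
  have hcomm : ∀ t, ρ t * ρ w * (ρ t)⁻¹ = ρ w ^ ((1 : ℤˣ) : ℤ) → Commute (ρ t) (ρ w) := by
    intro t ht
    exact Commute.of_conj_eq (by simpa using ht)
  obtain ⟨s, hs⟩ := hsign a ha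
  obtain ⟨t, ht⟩ := hsign b hb
  obtain ⟨u, hu⟩ := hsign z hz
  have hust : u = (s * t) ^ j := by
    refine sign_eq_of_eq_mul hs ht hu (n := ρ (((a * b) ^ j)⁻¹ * z)) (j := j) ?_ ?_ hρww
    · simp only [map_mul, map_inv, map_zpow, mul_inv_cancel_left]
    · refine Odd.of_dvd_nat ?_ (orderOf_map_dvd ρ _)
      refine (mem_iff_odd_orderOf hN hk).mp ((QuotientGroup.eq_one_iff _).mp ?_)
      change π (((a * b) ^ j)⁻¹ * z) = 1
      rw [map_mul, map_inv, map_zpow, map_mul, hj, inv_mul_cancel]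
  have hzα : α (π z) = (-1) ^ j := by
    rw [hj]
    simp [haα, hbα]
  rcases Int.even_or_odd j with hje | hjo
  · rw [hje.neg_one_zpow] at hzα
    have hu1 : u = 1 := by
      obtain ⟨i, rfl⟩ := hje
      rw [hust, zpow_add, Int.units_mul_self]
    rw [hu1] at hu
    obtain ⟨ε, e1, e2⟩ := exists_sign_of_notMem h.isPGroup
      (notMem_zpowers_of_sign α (map_mul_self π ha) haα hzα hz1)
    obtain ⟨δ, d1, d2⟩ := exists_sign_of_notMem h.isPGroup
      (notMem_zpowers_of_sign β (map_mul_self π hb) hbβ (hzαβ ▸ hzα) hz1)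
    refine hno (h.hasNet_of_commute ρ σ hσ haX hbX hzX hwX ha hb hz hab hza.symm hzb.symm hw hπw
      (hcomm z hu) hρwo hρw1 hρn (fun g => α g * ε g) (fun g => β g * δ g) (fun g => ?_)
      (fun g => ?_) (fun g => ?_) fun g => ?_)
    · rw [e1 g _ (Subgroup.mem_zpowers _), map_mul, haα, mul_neg_one, neg_mul]
    · rw [e2, map_mul, hzα, mul_one, mul_neg]
    · rw [d1 g _ (Subgroup.mem_zpowers _), map_mul, hbβ, mul_neg_one, neg_mul]
    · rw [d2, map_mul, ← hzαβ, hzα, mul_one, mul_neg]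
  · rw [hjo.neg_one_zpow] at hzα
    have hzβ : β (π z) = -1 := hzαβ ▸ hzα
    have hu' : u = s * t := by
      obtain ⟨i, rfl⟩ := hjo
      rw [hust, zpow_add, zpow_mul, zpow_two, Int.units_mul_self, one_zpow, one_mul, zpow_one]
    have hstu : s = 1 ∨ t = 1 ∨ u = 1 := by
      rcases Int.units_eq_one_or s with rfl | rfl
      · exact Or.inl rfl
      · rcases Int.units_eq_one_or t with rfl | rfl
        · exact Or.inr (Or.inl rfl)
        · exact Or.inr (Or.inr (by simpa using hu'))
    rcases hstu with rfl | rfl | rfl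
    · exact hno (h.hasNet_of_commute ρ σ hσ hbX hzX haX hwX hb hz ha hzb.symm hab.symm hza hw hπw
        (hcomm a hs) hρwo hρw1 hρn (fun g => α g * β g) (fun g => α g) (by simp [hbα, hbβ])
        (by simp [haα, haβ]) (by simp [hzα]) (by simp [haα]))
    · exact hno (h.hasNet_of_commute ρ σ hσ haX hzX hbX hwX ha hz hb hza.symm hab hzb hw hπw
        (hcomm b ht) hρwo hρw1 hρn (fun g => α g * β g) (fun g => β g) (by simp [haα, haβ])
        (by simp [hbα, hbβ]) (by simp [hzβ]) (by simp [hbβ]))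
    · exact hno (h.hasNet_of_commute ρ σ hσ haX hbX hzX hwX ha hb hz hab hza.symm hzb.symm hw hπw
        (hcomm z hu) hρwo hρw1 hρn (fun g => α g) (fun g => β g) (by simp [haα])
        (by simp [hzα]) (by simp [hbβ]) (by simp [hzβ]))

end MixedConnectionSet

/-- Every connected Cayley graph of valency at least four on a finite supersolvable
group with a noncyclic Sylow 2-subgroup admits a nowhere-zero 3-flow. -/
theorem cayley_supersolvable_noncyclic_sylow_nowhere_zero_3_flow
    {G : Type*} [Group G] [Fintype G] [DecidableEq G]
    (hss : IsSupersolvable G)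
    (hsyl : ∀ P : Sylow 2 G, ¬ IsCyclic ↥(P : Subgroup G))
    (X : Finset G) (h1 : (1 : G) ∉ X) (hinv : ∀ x ∈ X, x⁻¹ ∈ X)
    (hcard : 4 ≤ X.card) (hgen : Subgroup.closure (X : Set G) = ⊤) :
    HasNowhereZero3Flow (cayleyGraph (X : Set G)) := by
  refine HasNet.hasNowhereZero3Flow h1 ?_
  obtain ⟨n, c, hc⟩ := hss.exists_series
  obtain ⟨N, hNn, hN, k, hk⟩ := hc.exists_odd_complement
  have hP : IsPGroup 2 (G ⧸ N) := IsPGroup.of_card hk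
  let π := QuotientGroup.mk' N
  have hπ : ∀ t, t * t = 1 → t ≠ 1 → π t ≠ 1 := by
    intro t ht ht1 e
    exact ht1 (eq_one_of_mul_self_of_odd_orderOf ht
      ((mem_iff_odd_orderOf hN hk).mp ((QuotientGroup.eq_one_iff t).mp e)))
  rcases Nat.even_or_odd X.card with he | ho
  · exact hasNet_of_even hP π hπ _ X rfl h1 hinv he
  have h : IsOddConnectionSet π X := ⟨hP, hπ, h1, hinv, ho⟩
  have hcard5 : 5 ≤ X.card := by
    obtain ⟨i, hi⟩ := ho
    omega
  obtain ⟨χ₁, χ₂, hχ₁, hχ₂, hχ⟩ := exists_two_signs hP (not_isCyclic_quotient hN hsyl)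
  obtain ⟨x, hxX, y, hyX, α, β, hxα, hyα, hxβ, hyβ⟩ :=
    exists_dual_signs π (QuotientGroup.mk'_surjective N) hgen hχ₁ hχ₂ hχ
  rw [Finset.mem_coe] at hxX hyX
  have hxε : ∀ g, α (π (g * x)) * β (π (g * x)) = -(α (π g) * β (π g)) := by simp [hxα, hxβ]
  have hyε : ∀ g, α (π (g * y)) * β (π (g * y)) = -(α (π g) * β (π g)) := by simp [hyα, hyβ]
  by_cases hx : x * x = 1
  · by_cases hy : y * y = 1
    · by_cases hall : ∀ w ∈ X, w * w = 1
      · exact h.hasNet_of_forall_involution hcard5 hall hxX hyX hxα hyα hxβ hyβ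
      · push Not at hall
        obtain ⟨w, hwX, hw⟩ := hall
        exact IsOddConnectionSet.hasNet_of_mixed hc hN hk h hxX hyX hwX hx hy hw hxα hyα hxβ hyβ
    · exact h.involution_pair hxX hyX hx hy (fun g => α (π g) * β (π g)) hxε hyε
  · by_cases hy : y * y = 1
    · exact h.involution_pair hyX hxX hy hx (fun g => α (π g) * β (π g)) hyε hxε
    · exact h.hasNet_of_noninvolutions hxX hyX hx hy hxα hyα hxβ hyβ
end

section
/- Let G be a finite group and X ⊆ G \ {1} with X = X⁻¹, |X| = 5 and ⟨X⟩ = G. Suppose X = U ∪ {b, b⁻¹, z}, where: U is an inverse-closed set of exactly two elements, each of even order; z is an involution; b has order greater than 2 and ⟨b⟩ is a normal subgroup of G; and U, {b, b⁻¹} and {z} are pairwise disjoint. If ⟨U⟩ ∩ ⟨b⟩ = {1} and the centralizer C_G(⟨b⟩) of ⟨b⟩ in G has index at most 2 in G, then Cay(G,X) admits a nowhere-zero 3-flow. -/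
/-- Two fixed-point-free involutions of a set have a common proper 2-colouring. -/
theorem exists_sign_of_two_involutions {S : Type*} (f g : S → S)
    (hf : Function.Involutive f) (hg : Function.Involutive g)
    (hf' : ∀ x, f x ≠ x) (hg' : ∀ x, g x ≠ x) :
    ∃ θ : S → ℤˣ, ∀ x, θ (f x) = -θ x ∧ θ (g x) = -θ x := by
  classical
  let F : Equiv.Perm S := hf.toPerm f
  let K : Equiv.Perm S := hg.toPerm g
  let r := F * K
  have hFF : F * F = 1 := by ext x; exact hf x
  have hKK : K * K = 1 := by ext x; exact hg x
  have hFi : F⁻¹ = F := inv_eq_of_mul_eq_one_left hFF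
  have hKi : K⁻¹ = K := inv_eq_of_mul_eq_one_left hKK
  have hconj (j : ℤ) : F * r ^ j = r ^ (-j) * F := by
    have h1 : F * r ^ j * F⁻¹ = (F * r * F⁻¹) ^ j := by rw [conj_zpow]
    have h2 : F * r * F⁻¹ = r⁻¹ := by
      simp only [r, mul_inv_rev, hFi, hKi]
      rw [← mul_assoc, hFF, one_mul]
    rw [h2, inv_zpow, ← zpow_neg] at h1
    rw [← h1, inv_mul_cancel_right]
  have hne (x : S) : ¬ r.SameCycle x (f x) := by
    rintro ⟨i, hi⟩
    have hi : (r ^ i) x = F x := hi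
    rcases Int.even_or_odd' i with ⟨j, rfl | rfl⟩
    · apply hf' ((r ^ j) x)
      change (F * r ^ j) x = _
      rw [hconj, Equiv.Perm.mul_apply, ← hi, ← Equiv.Perm.mul_apply, ← zpow_add]
      congr 2; ring
    · apply hg' ((r ^ j) x)
      have h3 : F (K ((r ^ j) x)) = F ((r ^ j) x) := by
        change (r * r ^ j) x = (F * r ^ j) x
        rw [hconj, Equiv.Perm.mul_apply (r ^ (-j)), ← hi, ← Equiv.Perm.mul_apply, ← zpow_add,
          ← zpow_one_add]
        congr 2; ring
      exact F.injective h3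
  have hgf (x : S) : r.SameCycle (g x) (f x) := by
    refine ⟨1, ?_⟩
    change F (K (g x)) = f x
    exact congrArg f (hg x)
  have hfg (x : S) : r.SameCycle x (f (g x)) := ⟨1, rfl⟩
  let q : S → Quotient (Equiv.Perm.SameCycle.setoid r) := Quotient.mk _
  have hq {x y : S} : q x = q y ↔ r.SameCycle x y :=
    Quotient.eq (r := Equiv.Perm.SameCycle.setoid r)
  have h1 (x : S) : q x ≠ q (f x) := fun h => hne x (hq.1 h)
  have h2 (x : S) : q (g x) = q (f x) := hq.2 (hgf x)
  have h3 (x : S) : q (f (g x)) = q x := (hq.2 (hfg x)).symm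
  have key (A B : Quotient (Equiv.Perm.SameCycle.setoid r)) (h : A ≠ B) :
      (if WellOrderingRel B A then (1 : ℤˣ) else -1) = -(if WellOrderingRel A B then 1 else -1) := by
    rcases trichotomous_of WellOrderingRel A B with h' | h' | h'
    · simp [h', asymm_of WellOrderingRel h']
    · exact absurd h' h
    · simp [h', asymm_of WellOrderingRel h']
  refine ⟨fun x => if WellOrderingRel (q x) (q (f x)) then 1 else -1, fun x => ⟨?_, ?_⟩⟩
  · simp only [hf x]
    exact key _ _ (h1 x)
  · simp only [h2, h3]
    exact key _ _ (h1 x)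

/-- Right multiplication by an element of even order has a proper 2-colouring. -/
theorem exists_sign_of_even_orderOf {G : Type*} [Group G] {u : G} (hu : Even (orderOf u)) :
    ∃ σ : G → ℤˣ, ∀ g, σ (g * u) = -σ g := by
  have hex (g : G) : ∃ i : ℤ, (g : G ⧸ Subgroup.zpowers u).out * u ^ i = g := by
    obtain ⟨⟨h, i, rfl⟩, hh⟩ := QuotientGroup.mk_out_eq_mul (Subgroup.zpowers u) g
    exact ⟨-i, by simp [hh]⟩
  choose i hi using hex
  refine ⟨fun g => (-1) ^ i g, fun g => ?_⟩
  have hq : ((g * u : G) : G ⧸ Subgroup.zpowers u) = g :=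
    QuotientGroup.mk_mul_of_mem _ (Subgroup.mem_zpowers u)
  have h := hi (g * u)
  rw [hq] at h
  nth_rewrite 3 [← hi g] at h
  rw [mul_assoc, mul_right_inj, ← zpow_add_one, zpow_eq_zpow_iff_modEq] at h
  have h2 : (2 : ℤ) ∣ i g + 1 - i (g * u) :=
    (by exact_mod_cast hu.two_dvd : (2 : ℤ) ∣ orderOf u).trans h.dvd
  obtain ⟨c, hc⟩ := h2
  have : i (g * u) = i g + 1 + 2 * (-c) := by omega
  simp [this, zpow_add, zpow_mul]

/-- A free action admits an equivariant map to the acting group. -/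
theorem exists_equivariant_map {H S : Type*} [Group H] [MulAction H S]
    (hfree : ∀ (h : H) (s : S), h • s = s → h = 1) :
    ∃ F : S → H, ∀ h s, F (h • s) = h * F s := by
  have hex (s : S) : ∃ h : H,
      h • (Quotient.mk (MulAction.orbitRel H S) s).out = s := by
    have : MulAction.orbitRel H S s (Quotient.mk (MulAction.orbitRel H S) s).out :=
      (MulAction.orbitRel H S).symm (Quotient.mk_out (s := MulAction.orbitRel H S) s)
    exact this
  choose F hF using hex
  refine ⟨F, fun h s => ?_⟩
  have hq : Quotient.mk (MulAction.orbitRel H S) (h • s) = Quotient.mk _ s :=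
    Quotient.sound (s := MulAction.orbitRel H S) ⟨h, rfl⟩
  have h1 := hF (h • s)
  rw [hq] at h1
  nth_rewrite 3 [← hF s] at h1
  rw [← mul_smul] at h1
  have := hfree ((h * F s)⁻¹ * F (h • s)) _ (by rw [mul_smul, h1, inv_smul_smul])
  rw [inv_mul_eq_one] at this
  exact this.symm

/-- A nowhere-zero 3-flow on a Cayley graph, described by its values `φ g x` on the arcs
from `g` to `g * x`. -/
theorem hasNowhereZero3Flow_cayleyGraph {G : Type*} [Group G] [Fintype G] [DecidableEq G]
    (X : Finset G) (h1 : (1 : G) ∉ X) (hinv : ∀ x ∈ X, x⁻¹ ∈ X) (φ : G → G → ℤ)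
    (hanti : ∀ g, ∀ x ∈ X, φ (g * x) x⁻¹ = -φ g x)
    (hnz : ∀ g, ∀ x ∈ X, 0 < |φ g x| ∧ |φ g x| < 3)
    (hsum : ∀ g, ∑ x ∈ X, φ g x = 0) :
    HasNowhereZero3Flow (cayleyGraph (X : Set G)) := by
  have hsymm (g h : G) : h⁻¹ * g ∈ X ↔ g⁻¹ * h ∈ X := by
    constructor <;> intro hx <;> simpa using hinv _ hx
  have hadj (g h : G) : (cayleyGraph (X : Set G)).Adj g h ↔ g⁻¹ * h ∈ X := by
    simp only [cayleyGraph, SimpleGraph.fromRel_adj, Finset.mem_coe, hsymm, or_self]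
    refine ⟨And.right, fun hx => ⟨?_, hx⟩⟩
    rintro rfl
    simp [h1] at hx
  refine ⟨fun g h => if g⁻¹ * h ∈ X then φ g (g⁻¹ * h) else 0, ?_, ?_, ?_, ?_⟩
  · intro g h
    by_cases hx : g⁻¹ * h ∈ X
    · have := hanti g _ hx
      simp only [mul_inv_cancel_left, mul_inv_rev, inv_inv] at this
      simp [hx, (hsymm g h).2 hx, this]
    · simp [hx, mt (hsymm g h).1 hx]
  · intro g h hn
    rw [hadj] at hn
    simp [hn]
  · intro g h hn
    rw [hadj] at hn
    simpa [hn] using hnz g _ hn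
  · intro g
    refine Eq.trans ?_ (hsum g)
    rw [← Equiv.sum_comp (Equiv.mulLeft g)]
    simp

/-- In the 2-factor generated by two elements `u`, `v` with `{u, v}` inverse-closed, a sign `σ`
alternating along edges splits the edges into the perfect matchings `g — g * u ^ σ g` and
`g — g * v ^ σ g`. Together with `b` and an involution `z`, values on these matchings, on the
arcs from `g` to `g * b`, and on the edges of `z` that are balanced at each vertex yield a flow. -/
theorem hasNowhereZero3Flow_of_matchings {G : Type*} [Group G] [Fintype G] [DecidableEq G]
    (X : Finset G) (h1 : (1 : G) ∉ X) (hinv : ∀ x ∈ X, x⁻¹ ∈ X) {u v b z : G}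
    (hX : X = {u, v} ∪ {b, b⁻¹, z}) (huv : u ≠ v) (hUV : v = u⁻¹ ∨ u⁻¹ = u ∧ v⁻¹ = v)
    (hbu : b ≠ u) (hbv : b ≠ v) (hbu' : b⁻¹ ≠ u) (hbv' : b⁻¹ ≠ v) (hzu : z ≠ u) (hzv : z ≠ v)
    (hbb : b⁻¹ ≠ b) (hzb : z ≠ b) (hzb' : z ≠ b⁻¹) (hz : z⁻¹ = z)
    (σ : G → ℤˣ) (hσu : ∀ g, σ (g * u) = -σ g) (hσv : ∀ g, σ (g * v) = -σ g)
    (A B c f : G → ℤ)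
    (hA : ∀ g, A (g * u ^ (σ g : ℤ)) = -A g) (hB : ∀ g, B (g * v ^ (σ g : ℤ)) = -B g)
    (hf : ∀ g, f (g * z) = -f g)
    (hA0 : ∀ g, 0 < |A g| ∧ |A g| < 3) (hB0 : ∀ g, 0 < |B g| ∧ |B g| < 3)
    (hc0 : ∀ g, 0 < |c g| ∧ |c g| < 3) (hf0 : ∀ g, 0 < |f g| ∧ |f g| < 3)
    (hsum : ∀ g, A g + B g + (c g - c (g * b⁻¹)) + f g = 0) :
    HasNowhereZero3Flow (cayleyGraph (X : Set G)) := by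
  have hne (s : ℤˣ) : v ^ (s : ℤ) ≠ u ^ (s : ℤ) := by
    rcases Int.units_eq_one_or s with rfl | rfl <;> simpa using huv.symm
  have hor (s : ℤˣ) : (u = u ^ (s : ℤ) ∧ v = v ^ (s : ℤ)) ∨ (u = v ^ (s : ℤ) ∧ v = u ^ (s : ℤ)) := by
    rcases Int.units_eq_one_or s with rfl | rfl
    · simp
    · rcases hUV with rfl | ⟨h, h'⟩
      · simp
      · simp [h, h']
  have hUinv (x : G) (hx : x = u ∨ x = v) : x⁻¹ = u ∨ x⁻¹ = v := by
    rcases hUV with rfl | ⟨h, h'⟩ <;> rcases hx with rfl | rfl <;> simp [*]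
  let ψ : G → G → ℤ := fun g x => if x = u ^ (σ g : ℤ) then A g else B g
  have hψ (g x : G) (hx : x = u ∨ x = v) : ψ (g * x) x⁻¹ = -ψ g x := by
    have hσ : σ (g * x) = -σ g := by rcases hx with rfl | rfl <;> simp [hσu, hσv]
    have hx' : x = u ^ (σ g : ℤ) ∨ x = v ^ (σ g : ℤ) := by
      rcases hor (σ g) with ⟨h, h'⟩ | ⟨h, h'⟩ <;> rcases hx with rfl | rfl <;> simp [← h, ← h']
    simp only [ψ, hσ, Units.val_neg, zpow_neg, inv_inj]
    rcases hx' with rfl | rfl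
    · simp [hA]
    · simp [hne, hB]
  have hψsum (g : G) : ψ g u + ψ g v = A g + B g := by
    rcases hor (σ g) with ⟨h, h'⟩ | ⟨h, h'⟩
    · simp only [ψ, ← h, if_true, if_neg huv.symm]
    · simp only [ψ, ← h', if_true, if_neg huv, add_comm]
  let φ : G → G → ℤ := fun g x =>
    if x = u ∨ x = v then ψ g x else if x = b then c g else if x = b⁻¹ then -c (g * b⁻¹) else f g
  have hφb (g : G) : φ g b = c g := by simp [φ, hbu, hbv]
  have hφb' (g : G) : φ g b⁻¹ = -c (g * b⁻¹) := by simp [φ, hbu', hbv', hbb]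
  have hφz (g : G) : φ g z = f g := by simp [φ, hzu, hzv, hzb, hzb']
  have hφU (g x : G) (hx : x = u ∨ x = v) : φ g x = ψ g x := by simp [φ, hx]
  have hmem (x : G) : x ∈ X ↔ (x = u ∨ x = v) ∨ x = b ∨ x = b⁻¹ ∨ x = z := by
    simp [hX]; tauto
  refine hasNowhereZero3Flow_cayleyGraph X h1 hinv φ ?_ ?_ ?_
  · intro g x hx
    rcases (hmem x).1 hx with h | rfl | rfl | rfl
    · rw [hφU _ _ h, hφU _ _ (hUinv x h), hψ g x h]
    · rw [hφb, hφb', mul_inv_cancel_right]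
    · rw [inv_inv, hφb, hφb', neg_neg]
    · rw [hz, hφz, hφz, hf]
  · intro g x hx
    rcases (hmem x).1 hx with h | rfl | rfl | rfl
    · rw [hφU _ _ h]
      simp only [ψ]
      split_ifs
      exacts [hA0 g, hB0 g]
    · rw [hφb]; exact hc0 g
    · rw [hφb', abs_neg]; exact hc0 _
    · rw [hφz]; exact hf0 g
  · intro g
    have hd : Disjoint ({u, v} : Finset G) {b, b⁻¹, z} := by
      simp [Finset.disjoint_left]
      exact ⟨⟨hbu.symm, hbu'.symm, hzu.symm⟩, hbv.symm, hbv'.symm, hzv.symm⟩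
    rw [hX, Finset.sum_union hd, Finset.sum_pair huv, Finset.sum_insert, Finset.sum_pair hzb'.symm,
      hφb, hφb', hφz, hφU _ _ (Or.inl rfl), hφU _ _ (Or.inr rfl), hψsum, ← hsum g]
    · ring
    · simp [hbb.symm, hzb.symm]

/-- If `⟨b⟩` is normal and meets `Q` trivially, then `G` has a level function that is constant
on left cosets of `Q` and changes along arcs of `b` by a sign depending only on the coset of
`⟨b⟩`, provided that conjugation acts on `⟨b⟩` modulo `m` by signs. -/
theorem exists_level {G : Type*} [Group G] {b : G} {Q : Subgroup G} {m : ℕ}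
    (hbn : (Subgroup.zpowers b).Normal) (hQ : Q ⊓ Subgroup.zpowers b = ⊥) (hm : m ∣ orderOf b)
    (hconj : ∀ g, ∃ t : ℤˣ, ∃ j : ℤ, g * b * g⁻¹ = b ^ j ∧ (j : ZMod m) = ((t : ℤ) : ZMod m)) :
    ∃ (ℓ : G → ZMod m) (t : G → ℤˣ), (∀ g, t (g * b) = t g) ∧
      (∀ g, ℓ (g * b) = ℓ g + ((t g : ℤ) : ZMod m)) ∧ ∀ g, ∀ q ∈ Q, ℓ (g * q) = ℓ g := by
  classical
  have hfree (x : Subgroup.zpowers b) (s : G ⧸ Q) (h : x • s = s) : x = 1 := by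
    induction s using QuotientGroup.induction_on with | H g =>
    have h' : ((x : G) * g : G) = (g : G ⧸ Q) := h
    rw [eq_comm, QuotientGroup.eq] at h'
    have h2 : g⁻¹ * (x * g) ∈ Q ⊓ Subgroup.zpowers b :=
      ⟨h', by simpa [mul_assoc] using hbn.conj_mem x x.2 g⁻¹⟩
    rw [hQ, Subgroup.mem_bot, inv_mul_eq_one, right_eq_mul] at h2
    exact Subtype.ext h2
  obtain ⟨F, hF⟩ := exists_equivariant_map hfree
  choose i hi using fun x : Subgroup.zpowers b => Subgroup.mem_zpowers_iff.1 x.2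
  have hcast {j k : ℤ} (h : b ^ j = b ^ k) : (j : ZMod m) = k := by
    rw [zpow_eq_zpow_iff_modEq] at h
    rw [ZMod.intCast_eq_intCast_iff]
    exact h.of_dvd (by exact_mod_cast hm)
  let P : G → ℤˣ → Prop := fun y t => ∃ j : ℤ, y = b ^ j ∧ (j : ZMod m) = ((t : ℤ) : ZMod m)
  have ht (g : G) : P (g * b * g⁻¹) (if P (g * b * g⁻¹) 1 then 1 else -1) := by
    split_ifs with h
    · exact h
    · obtain ⟨t, ht⟩ := hconj g
      rcases Int.units_eq_one_or t with rfl | rfl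
      exacts [absurd ht h, ht]
  refine ⟨fun g => i (F g), fun g => if P (g * b * g⁻¹) 1 then 1 else -1, fun g => ?_,
    fun g => ?_, fun g q hq => ?_⟩
  · have : g * b * b * (g * b)⁻¹ = g * b * g⁻¹ := by group
    simp only [this]
  · obtain ⟨j, hj, hjt⟩ := ht g
    rw [← hjt, ← Int.cast_add]
    apply hcast
    let y : Subgroup.zpowers b := ⟨g * b * g⁻¹, hbn.conj_mem b (Subgroup.mem_zpowers b) g⟩
    have h2 : ((g * b : G) : G ⧸ Q) = y • (g : G ⧸ Q) := by
      change _ = ((g * b * g⁻¹ * g : G) : G ⧸ Q)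
      rw [inv_mul_cancel_right]
    rw [h2, hi, hF, (Subgroup.zpowers_isMulCommutative b).is_comm.comm y, zpow_add, hi,
      Subgroup.coe_mul, ← hj]
  · have : ((g * q : G) : G ⧸ Q) = g := QuotientGroup.mk_mul_of_mem g hq
    simp only [this]

/-- Suppose `⟨b⟩` is normal of odd order with centralizer of index at most two. Then conjugation
acts by signs on some nontrivial quotient of `⟨b⟩`. -/
theorem exists_modulus {G : Type*} [Group G] [Finite G] {b : G}
    (hb : 2 < orderOf b) (hodd : Odd (orderOf b)) (hbn : (Subgroup.zpowers b).Normal)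
    (hcent : (Subgroup.centralizer (Subgroup.zpowers b : Set G)).index ≤ 2) :
    ∃ m : ℕ, 3 ≤ m ∧ Odd m ∧ m ∣ orderOf b ∧
      ∀ g, ∃ t : ℤˣ, ∃ j : ℤ, g * b * g⁻¹ = b ^ j ∧ (j : ZMod m) = ((t : ℤ) : ZMod m) := by
  by_cases h : ∀ g, g * b * g⁻¹ = b ∨ g * b * g⁻¹ = b⁻¹
  · refine ⟨orderOf b, hb, hodd, dvd_rfl, fun g => ?_⟩
    rcases h g with h | h
    · exact ⟨1, 1, by simpa using h, by simp⟩
    · exact ⟨-1, -1, by simpa using h, by simp⟩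
  push Not at h
  obtain ⟨g₀, h₀, h₀'⟩ := h
  set C := Subgroup.centralizer (Subgroup.zpowers b : Set G) with hC
  have hmemC {g : G} : g ∈ C ↔ g * b * g⁻¹ = b := by
    rw [hC, Subgroup.mem_centralizer_iff]
    constructor
    · intro h
      rw [← h b (Subgroup.mem_zpowers b), mul_inv_cancel_right]
    · rintro h _ ⟨i, rfl⟩
      have h2 : g * b ^ i * g⁻¹ = b ^ i := by rw [← conj_zpow, h]
      exact (mul_inv_eq_iff_eq_mul.1 h2).symm
  have hg₀ : g₀ ∉ C := fun h => h₀ (hmemC.1 h)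
  have hindex : C.index = 2 := by
    have h1 : C.index ≠ 1 := fun h => hg₀ (by simp [Subgroup.index_eq_one.1 h])
    have h0 : C.index ≠ 0 := Subgroup.FiniteIndex.index_ne_zero
    omega
  obtain ⟨k, hk⟩ := Subgroup.mem_zpowers_iff.1 (hbn.conj_mem b (Subgroup.mem_zpowers b) g₀)
  have hk2 : b ^ (k * k) = b := by
    have h2 : g₀ * g₀ ∈ C := Subgroup.mul_self_mem_of_index_two hindex g₀
    rw [hmemC] at h2
    calc b ^ (k * k) = g₀ * (g₀ * b * g₀⁻¹) * g₀⁻¹ := by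
          rw [← hk, ← conj_zpow, ← hk, zpow_mul]
      _ = g₀ * g₀ * b * (g₀ * g₀)⁻¹ := by group
      _ = b := h2
  have hdvd : (orderOf b : ℤ) ∣ (k + 1) * (k - 1) := by
    rw [orderOf_dvd_iff_zpow_eq_one]
    have : (k + 1) * (k - 1) = k * k - 1 := by ring
    rw [this, zpow_sub_one, hk2, mul_inv_cancel]
  refine ⟨Int.gcd (orderOf b) (k - 1), ?_, ?_, ?_, fun g => ?_⟩
  · have hodd' : Odd (Int.gcd (orderOf b) (k - 1)) :=
      hodd.of_dvd_nat (by exact_mod_cast Int.gcd_dvd_left (orderOf b : ℤ) (k - 1))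
    have hne : Int.gcd (orderOf b) (k - 1) ≠ 1 := by
      intro hg
      have := Int.dvd_of_dvd_mul_left_of_gcd_one hdvd hg
      rw [orderOf_dvd_iff_zpow_eq_one, zpow_add_one, hk, mul_eq_one_iff_eq_inv] at this
      exact h₀' this
    obtain ⟨r, hr⟩ := hodd'
    omega
  · exact hodd.of_dvd_nat (by exact_mod_cast Int.gcd_dvd_left (orderOf b : ℤ) (k - 1))
  · exact_mod_cast Int.gcd_dvd_left (orderOf b : ℤ) (k - 1)
  · by_cases hg : g ∈ C
    · exact ⟨1, 1, by simpa using hmemC.1 hg, by simp⟩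
    · refine ⟨1, k, ?_, ?_⟩
      · have h2 : g₀⁻¹ * g ∈ C := by
          rw [Subgroup.mul_mem_iff_of_index_two hindex, inv_mem_iff]
          exact iff_of_false hg₀ hg
        rw [hmemC] at h2
        rw [hk]
        calc g * b * g⁻¹ = g₀ * (g₀⁻¹ * g * b * (g₀⁻¹ * g)⁻¹) * g₀⁻¹ := by group
          _ = _ := by rw [h2]
      · rw [ZMod.intCast_eq_intCast_iff_dvd_sub, ← dvd_neg]
        simpa using Int.gcd_dvd_right (orderOf b : ℤ) (k - 1)

/-- Two elements whose images modulo a normal subgroup are involutions have a common sign function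
on the quotient. -/
theorem exists_sign_of_mul_self_mem {G : Type*} [Group G] {N : Subgroup G} [N.Normal] {x y : G}
    (hx : x * x ∈ N) (hy : y * y ∈ N) (hx' : x ∉ N) (hy' : y ∉ N) :
    ∃ χ : G ⧸ N → ℤˣ, ∀ g : G ⧸ N, χ (g * (x : G)) = -χ g ∧ χ (g * (y : G)) = -χ g := by
  have hinvol {x : G} (hx : x * x ∈ N) : Function.Involutive fun g : G ⧸ N => g * (x : G) := by
    intro g
    simp only
    rw [mul_assoc, ← QuotientGroup.mk_mul, (QuotientGroup.eq_one_iff _).2 hx, mul_one]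
  have hfpf {x : G} (hx : x ∉ N) (g : G ⧸ N) : g * (x : G) ≠ g := by
    intro h
    rw [mul_eq_left, QuotientGroup.eq_one_iff] at h
    exact hx h
  exact exists_sign_of_two_involutions _ _ (hinvol hx) (hinvol hy) (hfpf hx') (hfpf hy')

/-- A sign function on `G` that is constant on cosets of `⟨b⟩` and alternates along the edges of
an inverse-closed pair `{u, v}` of elements of even order. -/
theorem exists_sign_of_pair {G : Type*} [Group G] {u v b : G}
    (hUV : v = u⁻¹ ∨ u⁻¹ = u ∧ v⁻¹ = v) (hu : Even (orderOf u)) (hv : Even (orderOf v))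
    (hbn : (Subgroup.zpowers b).Normal) {Q : Subgroup G} (huQ : u ∈ Q) (hvQ : v ∈ Q)
    (hQ : Q ⊓ Subgroup.zpowers b = ⊥) :
    ∃ σ : G ⧸ Subgroup.zpowers b → ℤˣ, ∀ g : G ⧸ Subgroup.zpowers b,
      σ (g * (u : G)) = -σ g ∧ σ (g * (v : G)) = -σ g := by
  have hbot {x : G} (hx : x ∈ Q) (hx' : (x : G ⧸ Subgroup.zpowers b) = 1) : x = 1 := by
    rw [QuotientGroup.eq_one_iff] at hx'
    exact (Subgroup.mem_bot).1 (hQ ▸ ⟨hx, hx'⟩)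
  rcases hUV with rfl | ⟨h, h'⟩
  · have heven : Even (orderOf (u : G ⧸ Subgroup.zpowers b)) := by
      have : orderOf u ∣ orderOf (u : G ⧸ Subgroup.zpowers b) := by
        rw [orderOf_dvd_iff_pow_eq_one]
        refine hbot (pow_mem huQ _) ?_
        rw [QuotientGroup.mk_pow, pow_orderOf_eq_one]
      exact even_iff_two_dvd.2 (hu.two_dvd.trans this)
    obtain ⟨σ, hσ⟩ := exists_sign_of_even_orderOf heven
    refine ⟨σ, fun g => ⟨hσ g, ?_⟩⟩
    have := hσ (g * ((u⁻¹ : G) : G ⧸ Subgroup.zpowers b))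
    rw [mul_assoc, ← QuotientGroup.mk_mul, inv_mul_cancel, QuotientGroup.mk_one, mul_one] at this
    rw [this, neg_neg]
  · have hmul {x : G} (hx : x⁻¹ = x) : x * x ∈ Subgroup.zpowers b := by
      rw [inv_eq_iff_mul_eq_one.1 hx]
      exact one_mem _
    have hnot {x : G} (hx : x ∈ Q) (hx' : Even (orderOf x)) : x ∉ Subgroup.zpowers b := by
      intro h
      rw [hbot hx ((QuotientGroup.eq_one_iff _).2 h), orderOf_one] at hx'
      exact absurd hx' (by decide)
    exact exists_sign_of_mul_self_mem (hmul h) (hmul h') (hnot huQ hu) (hnot hvQ hv)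

/-- Values around an odd cycle `ZMod m`: an almost alternating sign `α` on the second matching,
multipliers `κ` on the first matching and values `γ` on the cycle, for a vertex of relative
colour `s`. -/
theorem exists_odd_cycle_values {m : ℕ} (hm : 3 ≤ m) (hodd : Odd m) :
    ∃ (α : ZMod m → ℤ) (κ γ : ℤˣ → ZMod m → ℤ),
      (∀ i, 0 < |α i| ∧ |α i| < 3) ∧ (∀ s i, 0 < |κ s i| ∧ |κ s i| < 3) ∧
      (∀ s i, 0 < |γ s i| ∧ |γ s i| < 3) ∧
      ∀ (s : ℤˣ) i, (s : ℤ) * κ s i + α i + (γ s i - γ s (i - 1)) - s = 0 := by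
  have : NeZero m := ⟨by omega⟩
  have : Fact (1 < m) := ⟨by omega⟩
  let α : ℕ → ℤ := fun i => if i % 2 = 0 then 1 else -1
  let κ : ℤˣ → ℕ → ℤ := fun s i =>
    if s = 1 then (if i = 0 then -1 else if i = 1 then 2 else 1) else if i = 0 then 2 else 1
  let γ : ℤˣ → ℕ → ℤ := fun s i => if s = 1 ∧ i = 0 then 2 else if i % 2 = 0 then 1 else 2
  refine ⟨fun i => α i.val, fun s i => κ s i.val, fun s i => γ s i.val, ?_, ?_, ?_, ?_⟩
  · intro i
    simp only [α]
    split_ifs <;> simp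
  · intro s i
    simp only [κ]
    split_ifs <;> simp
  · intro s i
    simp only [γ]
    split_ifs <;> simp
  · intro s i
    have hval : (i - 1).val = if i.val = 0 then m - 1 else i.val - 1 := by
      split_ifs with h
      · rw [ZMod.val_eq_zero] at h
        rw [h, zero_sub, ZMod.neg_val, ZMod.val_one, if_neg one_ne_zero]
      · rw [ZMod.val_sub (by rw [ZMod.val_one]; omega), ZMod.val_one]
    simp only [hval]
    obtain ⟨r, hr⟩ := hodd
    rcases Int.units_eq_one_or s with rfl | rfl
    · simp only [α, κ, γ, if_true, true_and, Units.val_one]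
      split_ifs <;> omega
    · have : (-1 : ℤˣ) ≠ 1 := by decide
      simp only [α, κ, γ, this, if_false, false_and, Units.val_neg, Units.val_one]
      split_ifs <;> omega

/-- A flow when `b` has odd order. -/
theorem hasNowhereZero3Flow_of_odd {G : Type*} [Group G] [Fintype G] [DecidableEq G]
    (X : Finset G) (h1 : (1 : G) ∉ X) (hinv : ∀ x ∈ X, x⁻¹ ∈ X) {u v b z : G}
    (hX : X = {u, v} ∪ {b, b⁻¹, z}) (huv : u ≠ v) (hUV : v = u⁻¹ ∨ u⁻¹ = u ∧ v⁻¹ = v)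
    (hbu : b ≠ u) (hbv : b ≠ v) (hbu' : b⁻¹ ≠ u) (hbv' : b⁻¹ ≠ v) (hzu : z ≠ u) (hzv : z ≠ v)
    (hbb : b⁻¹ ≠ b) (hzb : z ≠ b) (hzb' : z ≠ b⁻¹) (hz : z⁻¹ = z)
    (hzn : z ∉ Subgroup.zpowers b) (hbn : (Subgroup.zpowers b).Normal)
    {Q : Subgroup G} (huQ : u ∈ Q) (hvQ : v ∈ Q) (hQ : Q ⊓ Subgroup.zpowers b = ⊥)
    (σ : G ⧸ Subgroup.zpowers b → ℤˣ)
    (hσ : ∀ g : G ⧸ Subgroup.zpowers b, σ (g * (u : G)) = -σ g ∧ σ (g * (v : G)) = -σ g)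
    {m : ℕ} (hm : 3 ≤ m) (hodd : Odd m) (hmb : m ∣ orderOf b)
    (hconj : ∀ g, ∃ t : ℤˣ, ∃ j : ℤ, g * b * g⁻¹ = b ^ j ∧ (j : ZMod m) = ((t : ℤ) : ZMod m)) :
    HasNowhereZero3Flow (cayleyGraph (X : Set G)) := by
  have hσpow (s : ℤˣ) (g : G ⧸ Subgroup.zpowers b) : σ (g * ((u ^ (s : ℤ) : G))) = -σ g := by
    rcases Int.units_eq_one_or s with rfl | rfl
    · simpa using (hσ g).1
    · have := (hσ (g * (u : G ⧸ Subgroup.zpowers b)⁻¹)).1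
      rw [inv_mul_cancel_right] at this
      simp [this]
  have hσpow' (s : ℤˣ) (g : G ⧸ Subgroup.zpowers b) : σ (g * ((v ^ (s : ℤ) : G))) = -σ g := by
    rcases Int.units_eq_one_or s with rfl | rfl
    · simpa using (hσ g).2
    · have := (hσ (g * (v : G ⧸ Subgroup.zpowers b)⁻¹)).2
      rw [inv_mul_cancel_right] at this
      simp [this]
  obtain ⟨ℓ, t, ht, hℓ, hℓQ⟩ := exists_level hbn hQ hmb hconj
  obtain ⟨α, κ, γ, hα, hκ, hγ, hsum⟩ := exists_odd_cycle_values hm hodd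
  obtain ⟨θ, hθ⟩ := exists_sign_of_two_involutions
    (fun g : G ⧸ Subgroup.zpowers b => g * ((u ^ (σ g : ℤ) : G)))
    (fun g : G ⧸ Subgroup.zpowers b => g * (z : G))
    (by intro g; simp only [hσpow]; simp)
    (by
      intro g
      simp only
      nth_rewrite 2 [← hz]
      simp)
    (by
      intro g hg
      have h2 := hσpow (σ g) g
      rw [hg] at h2
      exact units_ne_neg_self _ h2)
    (by
      intro g hg
      rw [mul_eq_left, QuotientGroup.eq_one_iff] at hg
      exact hzn hg)
  have habs (s : ℤˣ) (x : ℤ) : |(s : ℤ) * x| = |x| := by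
    rcases Int.units_eq_one_or s with rfl | rfl <;> simp
  have hmkb (g : G) : ((g * b : G) : G ⧸ Subgroup.zpowers b) = g :=
    QuotientGroup.mk_mul_of_mem g (Subgroup.mem_zpowers b)
  let s : G → ℤˣ := fun g => σ (g : G ⧸ Subgroup.zpowers b) * θ (g : G ⧸ Subgroup.zpowers b)
  let c : G → ℤ := fun g => (σ (g : G ⧸ Subgroup.zpowers b) : ℤ) *
    ((t g : ℤ) * γ (s g) (if t g = 1 then ℓ g else ℓ g - 1))
  have hnet (g : G) : c g - c (g * b⁻¹) =
      (σ (g : G ⧸ Subgroup.zpowers b) : ℤ) * (γ (s g) (ℓ g) - γ (s g) (ℓ g - 1)) := by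
    obtain ⟨h, rfl⟩ : ∃ h, g = h * b := ⟨g * b⁻¹, by group⟩
    simp only [c, s, mul_inv_cancel_right, hmkb, ht, hℓ]
    rcases Int.units_eq_one_or (t h) with h | h
    · simp [h]
      ring
    · have h2 : (-1 : ℤˣ) ≠ 1 := by decide
      simp only [h, h2, if_false, Units.val_neg, Units.val_one, Int.cast_neg, Int.cast_one,
        ← sub_eq_add_neg]
      ring
  refine hasNowhereZero3Flow_of_matchings X h1 hinv hX huv hUV hbu hbv hbu' hbv' hzu hzv
    hbb hzb hzb' hz (fun g => σ g) (fun g => (hσ g).1) (fun g => (hσ g).2)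
    (fun g => (θ g : ℤ) * κ (s g) (ℓ g)) (fun g => (σ g : ℤ) * α (ℓ g)) c (fun g => -(θ g : ℤ))
    ?_ ?_ ?_ ?_ ?_ ?_ ?_ ?_
  · intro g
    have h2 := (hθ g).1
    have h3 := hσpow (σ g) g
    simp only [s, QuotientGroup.mk_mul] at h2 h3 ⊢
    rw [h2, h3, hℓQ _ _ (zpow_mem huQ _)]
    simp
  · intro g
    have h3 := hσpow' (σ g) g
    simp only [QuotientGroup.mk_mul] at h3 ⊢
    rw [h3, hℓQ _ _ (zpow_mem hvQ _)]
    simp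
  · intro g
    have h2 := (hθ g).2
    simp only [QuotientGroup.mk_mul] at h2 ⊢
    simp [h2]
  · intro g
    simpa only [habs] using hκ _ _
  · intro g
    simpa only [habs] using hα _
  · intro g
    simpa only [c, habs] using hγ _ _
  · intro g
    have := habs (θ g) 1
    rw [mul_one] at this
    simp [this]
  · intro g
    rw [hnet]
    have h2 := hsum (s g) (ℓ g)
    simp only [s, Units.val_mul] at h2 ⊢
    generalize κ (σ g * θ g) (ℓ g) = k at h2 ⊢
    generalize γ (σ g * θ g) (ℓ g) = c₁ at h2 ⊢
    generalize γ (σ g * θ g) (ℓ g - 1) = c₂ at h2 ⊢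
    rcases Int.units_eq_one_or (σ g) with h | h <;>
      rcases Int.units_eq_one_or (θ g) with h' | h' <;>
      simp only [h, h', Units.val_one, Units.val_neg] at h2 ⊢ <;> linarith

/-- Let `Cay(G, X)` be a connected simple Cayley graph of valency five on a finite group
`G`, with `X = U ∪ {b, b⁻¹, z}` where: `U` is an inverse-closed set of two elements of
even order; `z` is an involution; `b` has order greater than 2 and generates a normal
subgroup of `G`; and `U`, `{b, b⁻¹}`, `{z}` are pairwise disjoint.  If
`⟨U⟩ ∩ ⟨b⟩ = {1}` and the centralizer of `⟨b⟩` has index at most 2 in `G`, then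
`Cay(G, X)` admits a nowhere-zero 3-flow. -/
theorem cayley_valency_five_normal_cyclic_nowhere_zero_3_flow
    {G : Type*} [Group G] [Fintype G] [DecidableEq G]
    (X U : Finset G) (b z : G)
    (h1 : (1 : G) ∉ X) (hinv : ∀ x ∈ X, x⁻¹ ∈ X) (hcard : X.card = 5)
    (hgen : Subgroup.closure (X : Set G) = ⊤)
    (hX : X = U ∪ {b, b⁻¹, z})
    (hU2 : U.card = 2) (hUinv : ∀ u ∈ U, u⁻¹ ∈ U) (hUeven : ∀ u ∈ U, Even (orderOf u))
    (hz : orderOf z = 2)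
    (hb : 2 < orderOf b)
    (hbn : (Subgroup.zpowers b).Normal)
    (hbU : b ∉ U) (hbiU : b⁻¹ ∉ U) (hzU : z ∉ U) (hzb : z ≠ b) (hzbi : z ≠ b⁻¹)
    (hUb : Subgroup.closure (U : Set G) ⊓ Subgroup.zpowers b = ⊥)
    (hcent : (Subgroup.centralizer ((Subgroup.zpowers b : Subgroup G) : Set G)).index ≤ 2) :
    HasNowhereZero3Flow (cayleyGraph (X : Set G)) := by
  obtain ⟨u, v, huv, rfl⟩ := Finset.card_eq_two.1 hU2
  have hu : Even (orderOf u) := hUeven u (by simp)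
  have hv : Even (orderOf v) := hUeven v (by simp)
  have hUV : v = u⁻¹ ∨ u⁻¹ = u ∧ v⁻¹ = v := by
    have h2 := hUinv u (by simp)
    have h3 := hUinv v (by simp)
    simp only [Finset.mem_insert, Finset.mem_singleton] at h2 h3
    rcases h2 with h2 | h2
    · rcases h3 with h3 | h3
      · exact Or.inl (inv_eq_iff_eq_inv.1 h3)
      · exact Or.inr ⟨h2, h3⟩
    · exact Or.inl h2.symm
  simp only [Finset.mem_insert, Finset.mem_singleton, not_or] at hbU hbiU hzU
  have hbb : b⁻¹ ≠ b := by
    intro h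
    have : orderOf b ∣ 2 := orderOf_dvd_of_pow_eq_one (by rw [pow_two, ← inv_eq_iff_mul_eq_one, h])
    exact absurd (Nat.le_of_dvd two_pos this) (by omega)
  have hzz : z * z = 1 := by rw [← pow_two, ← hz, pow_orderOf_eq_one]
  have hzi : z⁻¹ = z := inv_eq_of_mul_eq_one_left hzz
  have hz1 : z ≠ 1 := by
    rintro rfl
    simp at hz
  set Q := Subgroup.closure ((({u, v} : Finset G)) : Set G)
  have huQ : u ∈ Q := Subgroup.subset_closure (by simp)
  have hvQ : v ∈ Q := Subgroup.subset_closure (by simp)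
  obtain ⟨σ, hσ⟩ := exists_sign_of_pair hUV hu hv hbn huQ hvQ hUb
  have hσu (g : G) : σ ((g * u : G)) = -σ g := (hσ g).1
  have hσv (g : G) : σ ((g * v : G)) = -σ g := (hσ g).2
  have habs (s : ℤˣ) : |(s : ℤ)| = 1 := by
    rcases Int.units_eq_one_or s with rfl | rfl <;> simp
  have halt {χ : G → ℤˣ} {x : G} (h : ∀ g, χ (g * x) = -χ g) (s : ℤˣ) (g : G) :
      χ (g * x ^ (s : ℤ)) = -χ g := by
    rcases Int.units_eq_one_or s with rfl | rfl
    · simpa using h g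
    · have := h (g * x⁻¹)
      rw [inv_mul_cancel_right] at this
      simp [this]
  rcases Nat.even_or_odd (orderOf b) with heven | hodd
  · by_cases hz2 : z ∈ Subgroup.zpowers (b ^ 2)
    · have hzcent (g : G) : g * z = z * g := by
        obtain ⟨j, hj⟩ := Subgroup.mem_zpowers_iff.1 hz2
        obtain ⟨k, hk⟩ := Subgroup.mem_zpowers_iff.1
          (hbn.conj_mem b (Subgroup.mem_zpowers b) g)
        have hzb : (b ^ (2 * j)) = z := by rw [← hj, zpow_mul]; norm_cast
        have hconj : g * z * g⁻¹ = z ^ k := by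
          rw [← hzb, ← conj_zpow, ← hk, ← zpow_mul, ← zpow_mul, mul_comm]
        rcases Int.even_or_odd' k with ⟨i, rfl | rfl⟩
        · rw [zpow_mul, zpow_two, hzz, one_zpow, mul_inv_eq_one, mul_eq_left] at hconj
          exact absurd hconj hz1
        · rw [zpow_add_one, zpow_mul, zpow_two, hzz, one_zpow, one_mul,
            mul_inv_eq_iff_eq_mul] at hconj
          exact hconj
      have hfpf (s : G ⧸ Q) : z • s ≠ s := by
        induction s using QuotientGroup.induction_on with | H g =>
        intro h
        have h' : ((z * g : G) : G ⧸ Q) = (g : G ⧸ Q) := h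
        rw [eq_comm, QuotientGroup.eq, ← hzcent, inv_mul_cancel_left] at h'
        have h2 : z ∈ Q ⊓ Subgroup.zpowers b :=
          ⟨h', Subgroup.zpowers_le.2 (Subgroup.pow_mem _ (Subgroup.mem_zpowers b) 2) hz2⟩
        rw [hUb, Subgroup.mem_bot] at h2
        exact hz1 h2
      have hinvol : Function.Involutive fun s : G ⧸ Q => z • s := by
        intro s
        simp only [smul_smul, hzz, one_smul]
      obtain ⟨τ, hτ⟩ := exists_sign_of_two_involutions _ _ hinvol hinvol hfpf hfpf
      have hτQ {q : G} (hq : q ∈ Q) (g : G) : τ ((g * q : G)) = τ g := by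
        rw [QuotientGroup.mk_mul_of_mem g hq]
      have hτz (g : G) : τ ((g * z : G)) = -τ g := by
        rw [hzcent]
        exact (hτ g).1
      have hzN : z ∈ Subgroup.zpowers b :=
        Subgroup.zpowers_le.2 (Subgroup.pow_mem _ (Subgroup.mem_zpowers b) 2) hz2
      have hσz (g : G) : σ ((g * z : G)) = σ g := by
        rw [QuotientGroup.mk_mul_of_mem g hzN]
      let χ : G → ℤˣ := fun g => σ g * τ g
      have hχu (g : G) : χ (g * u) = -χ g := by simp only [χ, hσu, hτQ huQ, neg_mul]
      have hχv (g : G) : χ (g * v) = -χ g := by simp only [χ, hσv, hτQ hvQ, neg_mul]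
      have hχz (g : G) : χ (g * z) = -χ g := by simp only [χ, hσz, hτz, mul_neg]
      refine hasNowhereZero3Flow_of_matchings X h1 hinv hX huv hUV hbU.1 hbU.2 hbiU.1 hbiU.2
        hzU.1 hzU.2 hbb hzb hzbi hzi (fun g => σ g) hσu hσv
        (fun g => χ g) (fun g => χ g) (fun _ => 1) (fun g => -2 * χ g)
        ?_ ?_ ?_ ?_ ?_ ?_ ?_ ?_
      · intro g
        simp only [halt hχu, Units.val_neg]
      · intro g
        simp only [halt hχv, Units.val_neg]
      · intro g
        simp [hχz]
      · simp [habs]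
      · simp [habs]
      · simp
      · simp [abs_mul, habs]
      · intro g
        ring
    · have hN2 : (Subgroup.zpowers (b ^ 2)).Normal := by
        refine ⟨fun x hx g => ?_⟩
        obtain ⟨i, rfl⟩ := Subgroup.mem_zpowers_iff.1 hx
        obtain ⟨k, hk⟩ := Subgroup.mem_zpowers_iff.1
          (hbn.conj_mem b (Subgroup.mem_zpowers b) g)
        refine Subgroup.mem_zpowers_iff.2 ⟨k * i, ?_⟩
        rw [← conj_zpow, ← conj_pow, ← hk]
        simp only [← zpow_natCast, ← zpow_mul]
        congr 1
        push_cast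
        ring
      have hb2 : b ∉ Subgroup.zpowers (b ^ 2) := by
        intro h
        obtain ⟨i, hi⟩ := Subgroup.mem_zpowers_iff.1 h
        have h2 : b ^ (2 * i - 1) = 1 := by
          rw [zpow_sub_one, mul_inv_eq_one, zpow_mul, zpow_ofNat, hi]
        have h3 := (Int.natCast_dvd_natCast.2 heven.two_dvd).trans
          (orderOf_dvd_iff_zpow_eq_one.2 h2)
        omega
      obtain ⟨χ, hχ⟩ := exists_sign_of_mul_self_mem
        (by rw [← pow_two]; exact Subgroup.mem_zpowers _) (by rw [hzz]; exact one_mem _) hb2 hz2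
      have hχb (g : G) : χ ((g * b⁻¹ : G)) = -χ g := by
        have := (hχ ((g * b⁻¹ : G))).1
        rw [← QuotientGroup.mk_mul, inv_mul_cancel_right] at this
        rw [this, neg_neg]
      have hχz (g : G) : χ ((g * z : G)) = -χ g := (hχ g).2
      refine hasNowhereZero3Flow_of_matchings X h1 hinv hX huv hUV hbU.1 hbU.2 hbiU.1 hbiU.2
        hzU.1 hzU.2 hbb hzb hzbi hzi (fun g => σ g) hσu hσv
        (fun g => σ g) (fun g => -σ g) (fun g => χ g) (fun g => -2 * χ g)
        ?_ ?_ ?_ ?_ ?_ ?_ ?_ ?_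
      · intro g
        simp only [halt (χ := fun g : G => σ g) hσu, Units.val_neg]
      · intro g
        simp only [halt (χ := fun g : G => σ g) hσv, Units.val_neg]
      · intro g
        simp only [hχz, Units.val_neg]
        ring
      · simp [habs]
      · simp [habs]
      · simp [habs]
      · simp [abs_mul, habs]
      · intro g
        simp only [hχb, Units.val_neg]
        ring
  · have hzn : z ∉ Subgroup.zpowers b := by
      intro h
      have h2 := orderOf_dvd_of_mem_zpowers h
      rw [hz] at h2
      exact (Nat.not_even_iff_odd.2 hodd) (even_iff_two_dvd.2 h2)
    obtain ⟨m, hm, hmodd, hmb, hconj⟩ := exists_modulus hb hodd hbn hcent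
    exact hasNowhereZero3Flow_of_odd X h1 hinv hX huv hUV hbU.1 hbU.2 hbiU.1 hbiU.2
      hzU.1 hzU.2 hbb hzb hzbi hzi hzn hbn huQ hvQ hUb σ hσ hm hmodd hmb hconj
end
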